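/- Let s ∈ ℂ with Re(s) > −1/2. For every N ≥ 1 let F_N be the Fredholm determinant associated with the rescaled kernel K_[N] and let F_∞ be the Fredholm determinant associated with the limiting kernel K_∞ (both restricted to (0,∞)²). Then F_N and F_∞ are three times continuously differentiable on (0,∞), and for every p ∈ {0,1,2,3} and every t > 0, the p-th derivative F_N^{(p)}(t) converges to F_∞^{(p)}(t) as N → ∞. -/

import Mathlib

noncomputable section

open Complex MeasureTheory Filter Set

/-- Rising Pochhammer symbol `(x)_n = x(x+1)⋯(x+n−1)`. -/
def poch (x : ℂ) (n : ℕ) : ℂ := ∏ i ∈ Finset.range n, (x + i)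

/-- Confluent hypergeometric series `₁F₁[r, q; z]`. -/
def oneF1 (r q z : ℂ) : ℂ := ∑' n : ℕ, poch r n / (poch q n * n.factorial) * z ^ n

/-- Terminating Gauss hypergeometric series `₂F₁[−m, b, c; z]`. -/
def twoF1neg (m : ℕ) (b c z : ℂ) : ℂ :=
  ∑ k ∈ Finset.range (m + 1),
    poch (-(m : ℂ)) k * poch b k / (poch c k * (k.factorial : ℂ)) * z ^ k

/-- The common prefactor `|2/x|^{Re s} e^{−i/x + π Im(s) Sgn(x)/2}`. -/
def prefac (s : ℂ) (x : ℝ) : ℂ :=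
  ((|2 / x| ^ s.re : ℝ) : ℂ) *
    Complex.exp (-Complex.I / (x : ℂ) + ((Real.pi * s.im * Real.sign x / 2 : ℝ) : ℂ))

/-- `P̃(x) = |2/x|^{Re s} e^{−i/x + π Im(s) Sgn(x)/2} ₁F₁[s, 2Re(s)+1; 2i/x]`. -/
def Ptilde (s : ℂ) (x : ℝ) : ℂ :=
  prefac s x * oneF1 s ((2 * s.re + 1 : ℝ) : ℂ) (2 * Complex.I / (x : ℂ))

/-- `Q(x) = (2/x)|2/x|^{Re s} e^{−i/x + π Im(s) Sgn(x)/2} ₁F₁[s+1, 2Re(s)+2; 2i/x]`. -/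
def Qfun (s : ℂ) (x : ℝ) : ℂ :=
  (2 / (x : ℂ)) * prefac s x * oneF1 (s + 1) ((2 * s.re + 2 : ℝ) : ℂ) (2 * Complex.I / (x : ℂ))

/-- The constant in front of the limiting kernel `K_∞`. -/
def cinf (s : ℂ) : ℂ :=
  (1 / (2 * (Real.pi : ℂ))) *
    (Complex.Gamma (s + 1) * Complex.Gamma ((starRingEnd ℂ) s + 1) /
      (Complex.Gamma ((2 * s.re + 1 : ℝ) : ℂ) * Complex.Gamma ((2 * s.re + 2 : ℝ) : ℂ)))

/-- The limiting kernel `K_∞`, as a complex number (it is in fact real). -/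
def KinfC (s : ℂ) (x y : ℝ) : ℂ :=
  if x = y then cinf s * (deriv (Ptilde s) x * Qfun s x - deriv (Qfun s) x * Ptilde s x)
  else cinf s * (Ptilde s x * Qfun s y - Qfun s x * Ptilde s y) / ((x : ℂ) - (y : ℂ))

/-- The limiting kernel `K_∞` (real-valued). -/
def Kinf (s : ℂ) (x y : ℝ) : ℝ := (KinfC s x y).re

/-- The generalized Cauchy weight `w_H` on `ℝ`. -/
def wH (s : ℂ) (N : ℕ) (x : ℝ) : ℝ :=
  (1 + x ^ 2) ^ (-s.re - (N : ℝ)) * Real.exp (2 * s.im * Complex.arg (1 + Complex.I * x))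

/-- The polynomial `p_{N−1}`. -/
def pPrev (s : ℂ) (N : ℕ) (x : ℝ) : ℂ :=
  ((x : ℂ) - Complex.I) ^ (N - 1) *
    twoF1neg (N - 1) (s + 1) ((2 * s.re + 2 : ℝ) : ℂ) (2 / (1 + Complex.I * (x : ℂ)))

/-- The polynomial `p̃_N`. -/
def pTil (s : ℂ) (N : ℕ) (x : ℝ) : ℂ :=
  ((x : ℂ) - Complex.I) ^ N *
    twoF1neg N s ((2 * s.re + 1 : ℝ) : ℂ) (2 / (1 + Complex.I * (x : ℂ)))

/-- The constant `C_{N,s}`. -/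
def CNs (s : ℂ) (N : ℕ) : ℂ :=
  (((2 : ℝ) ^ (2 * s.re) / Real.pi : ℝ) : ℂ) *
    (Complex.Gamma ((2 * s.re + N + 1 : ℝ) : ℂ) * Complex.Gamma (s + 1) *
        Complex.Gamma ((starRingEnd ℂ) s + 1) /
      (Complex.Gamma (N : ℂ) * Complex.Gamma ((2 * s.re + 1 : ℝ) : ℂ) *
        Complex.Gamma ((2 * s.re + 2 : ℝ) : ℂ)))

def phiN (s : ℂ) (N : ℕ) (x : ℝ) : ℂ := pTil s N x * (Real.sqrt (wH s N x) : ℂ)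

def psiN (s : ℂ) (N : ℕ) (x : ℝ) : ℂ := pPrev s N x * (Real.sqrt (wH s N x) : ℂ)

/-- The finite-`N` kernel `K_N` (complex form; extended to the diagonal by continuity,
i.e. by the Bernoulli–l'Hôpital expression). -/
def KNC (s : ℂ) (N : ℕ) (x y : ℝ) : ℂ :=
  if x = y then CNs s N * (deriv (phiN s N) x * psiN s N x - deriv (psiN s N) x * phiN s N x)
  else CNs s N * (phiN s N x * psiN s N y - psiN s N x * phiN s N y) / ((x : ℂ) - (y : ℂ))

/-- The finite-`N` kernel `K_N` (real-valued). -/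
def KN (s : ℂ) (N : ℕ) (x y : ℝ) : ℝ := (KNC s N x y).re

/-- The rescaled kernel `K_[N](x,y) = N · K_N(Nx, Ny)`. -/
def Kscaled (s : ℂ) (N : ℕ) (x y : ℝ) : ℝ := N * KN s N (N * x) (N * y)

/-- `P̃_N`. -/
def PtildeN (s : ℂ) (N : ℕ) (x : ℝ) : ℂ :=
  (((2 : ℝ) ^ s.re : ℝ) : ℂ) *
    (Real.sqrt (Real.Gamma (2 * s.re + N + 1) / (N * Real.Gamma N)) : ℂ) *
    pTil s N (N * x) * (Real.sqrt (wH s N (N * x)) : ℂ)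

/-- `Q_N`. -/
def QN (s : ℂ) (N : ℕ) (x : ℝ) : ℂ :=
  (((2 : ℝ) ^ (s.re + 1) : ℝ) : ℂ) *
    (Real.sqrt (N * Real.Gamma (2 * s.re + N + 1) / Real.Gamma N) : ℂ) *
    pPrev s N (N * x) * (Real.sqrt (wH s N (N * x)) : ℂ)

/-- `k`-point correlation function of a kernel. -/
def rhoK (K : ℝ → ℝ → ℝ) (k : ℕ) (x : Fin k → ℝ) : ℝ :=
  Matrix.det (Matrix.of fun i j => K (x i) (x j))

/-- The Fredholm determinant of a kernel restricted to `(t,∞)²`. -/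
def fredholmDet (K : ℝ → ℝ → ℝ) (t : ℝ) : ℝ :=
  1 + ∑' k : ℕ, ((-1 : ℝ) ^ (k + 1) / (k + 1).factorial) *
    ∫ x : Fin (k + 1) → ℝ in Set.univ.pi fun _ => Set.Ioi t, rhoK K (k + 1) x

/-- Mixed partial derivative `∂^{p+q}K/∂x^p∂y^q`. -/
def pderiv₂ (K : ℝ → ℝ → ℝ) (p q : ℕ) (x y : ℝ) : ℝ :=
  iteratedDeriv p (fun x' => iteratedDeriv q (fun y' => K x' y') y) x

/-- `F_{n,h,a}(x) = ₂F₁[−n, h, a; 2/(1+ix)]` (a terminating series). -/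
def Fnha (n : ℕ) (h : ℂ) (a : ℝ) (x : ℝ) : ℂ :=
  ∑' k : ℕ, poch (-(n : ℂ)) k * poch h k / (poch (a : ℂ) k * (k.factorial : ℂ)) *
    (2 / (1 + Complex.I * (x : ℂ))) ^ k

/-- `θ(τ) = τ (d/dτ) log F(τ⁻¹)`. -/
def thetaOf (F : ℝ → ℝ) (τ : ℝ) : ℝ := τ * deriv (fun u => Real.log (F u⁻¹)) τ

/-- Squared Vandermonde determinant `∏_{j<k} (x_j − x_k)²`. -/
def vandSq (N : ℕ) (x : Fin N → ℝ) : ℝ :=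
  ∏ p ∈ Finset.univ.filter fun p : Fin N × Fin N => p.1 < p.2, (x p.1 - x p.2) ^ 2

/-- `φ(x,y) = (f(x)g(y) − g(x)f(y))/(x−y)`, extended to the diagonal. -/
def phiFG (f g : ℝ → ℝ) (x y : ℝ) : ℝ :=
  if x = y then deriv f x * g x - deriv g x * f x else (f x * g y - g x * f y) / (x - y)

open scoped Topology

open scoped ComplexOrder in
/-- Hadamard's inequality for a matrix with bounded entries. -/
theorem norm_det_sq_le_of_entry_le {n : Type*} [Fintype n] [DecidableEq n] (A : Matrix n n ℂ)
    {M : ℝ} (hM : ∀ i j, ‖A i j‖ ≤ M) :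
    ‖A.det‖ ^ 2 ≤ (Fintype.card n * M ^ 2) ^ Fintype.card n := by
  classical
  rcases isEmpty_or_nonempty n with h | h
  · simp
  set B := A.conjTranspose * A with hB
  have hpos : B.PosSemidef := Matrix.posSemidef_conjTranspose_mul_self A
  have hdet : ‖A.det‖ ^ 2 = ∏ i, hpos.isHermitian.eigenvalues i := by
    have h1 : B.det = ((‖A.det‖ ^ 2 : ℝ) : ℂ) := by
      rw [hB, Matrix.det_mul, Matrix.det_conjTranspose, Complex.star_def, Complex.conj_mul']
      push_cast; rfl
    have h2 := hpos.isHermitian.det_eq_prod_eigenvalues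
    rw [h1] at h2
    refine Complex.ofReal_injective (h2.trans ?_)
    simp
  have htr : ∑ i, hpos.isHermitian.eigenvalues i = ∑ i, ∑ j, ‖A j i‖ ^ 2 := by
    have h2 := hpos.isHermitian.trace_eq_sum_eigenvalues
    have h1 : B.trace = ((∑ i, ∑ j, ‖A j i‖ ^ 2 : ℝ) : ℂ) := by
      simp only [hB, Matrix.trace, Matrix.diag, Matrix.mul_apply, Matrix.conjTranspose_apply,
        Complex.star_def, Complex.conj_mul']
      push_cast; rfl
    rw [h1] at h2
    refine (Complex.ofReal_injective (h2.trans ?_)).symm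
    simp
  have hc : (0 : ℝ) < Fintype.card n := by exact_mod_cast Fintype.card_pos
  have hsum : ∑ i, hpos.isHermitian.eigenvalues i ≤ Fintype.card n * (Fintype.card n * M ^ 2) := by
    rw [htr]
    calc ∑ i, ∑ j, ‖A j i‖ ^ 2 ≤ ∑ _i : n, ∑ _j : n, M ^ 2 := by
          gcongr with i _ j _
          exact hM j i
      _ = _ := by simp
  have hamgm := Real.geom_mean_le_arith_mean Finset.univ (fun _ : n => (1 : ℝ))
    hpos.isHermitian.eigenvalues (fun _ _ => zero_le_one) (by simpa using Fintype.card_pos)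
    (fun i _ => hpos.eigenvalues_nonneg i)
  simp only [Real.rpow_one, Finset.sum_const, Finset.card_univ, nsmul_eq_mul, mul_one,
    one_mul] at hamgm
  have hP : 0 ≤ ∏ i, hpos.isHermitian.eigenvalues i :=
    Finset.prod_nonneg fun i _ => hpos.eigenvalues_nonneg i
  have hle : (∏ i, hpos.isHermitian.eigenvalues i) ^ ((Fintype.card n : ℝ)⁻¹)
      ≤ Fintype.card n * M ^ 2 := by
    refine hamgm.trans ?_
    rw [div_le_iff₀ hc]
    linarith
  rw [hdet]
  calc ∏ i, hpos.isHermitian.eigenvalues i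
      = ((∏ i, hpos.isHermitian.eigenvalues i) ^ ((Fintype.card n : ℝ)⁻¹)) ^ Fintype.card n := by
        rw [Real.rpow_inv_natCast_pow hP Fintype.card_ne_zero]
    _ ≤ _ := pow_le_pow_left₀ (Real.rpow_nonneg hP _) hle _

/-- The numerical factor bounding the `m`-th term of a Fredholm series. -/
theorem sqrt_card_pow_div_factorial_le (m : ℕ) (C : ℝ) :
    Real.sqrt ((m * C ^ 2) ^ m) / m.factorial ≤
      (2 * Real.exp 1 * C ^ 2) ^ m / m.factorial + (1 / 2) ^ m := by
  have hf : (0 : ℝ) < m.factorial := by exact_mod_cast m.factorial_pos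
  have h1 : (m : ℝ) ^ m ≤ Real.exp 1 ^ m * m.factorial := by
    have := Real.pow_div_factorial_le_exp (m : ℝ) (Nat.cast_nonneg m) m
    rw [div_le_iff₀ hf] at this
    rwa [← Real.exp_nat_mul, mul_one]
  rw [div_le_iff₀ hf]
  refine Real.sqrt_le_iff.2 ⟨by positivity, ?_⟩
  set x := (2 * Real.exp 1 * C ^ 2) ^ m / m.factorial with hx
  have hx0 : 0 ≤ x := by positivity
  have hxy : x * (1 / 2) ^ m = (Real.exp 1 * C ^ 2) ^ m / m.factorial := by
    rw [hx, div_mul_eq_mul_div, ← mul_pow]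
    congr 2
    ring
  have hy0 : (0 : ℝ) ≤ (1 / 2) ^ m := by positivity
  calc ((m : ℝ) * C ^ 2) ^ m = (m : ℝ) ^ m * (C ^ 2) ^ m := mul_pow _ _ _
    _ ≤ Real.exp 1 ^ m * m.factorial * (C ^ 2) ^ m := by gcongr
    _ = x * (1 / 2) ^ m * (m.factorial : ℝ) ^ 2 := by
      rw [hxy, mul_pow]; field_simp
    _ ≤ (x + (1 / 2) ^ m) ^ 2 * (m.factorial : ℝ) ^ 2 := by
      gcongr
      nlinarith
    _ = _ := by ring

/-- Derivatives of a bounded pointwise convergent sequence of holomorphic functions converge. -/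
theorem tendsto_iteratedDeriv_of_tendsto_of_bounded {f : ℕ → ℂ → ℂ} {g : ℂ → ℂ} {c : ℂ} {R M : ℝ}
    (hR : 0 < R) (hf : ∀ᶠ n in atTop, DiffContOnCl ℂ (f n) (Metric.ball c R))
    (hg : DiffContOnCl ℂ g (Metric.ball c R))
    (hM : ∀ᶠ n in atTop, ∀ z ∈ Metric.sphere c R, ‖f n z‖ ≤ M)
    (hlim : ∀ z ∈ Metric.sphere c R, Tendsto (fun n => f n z) atTop (𝓝 (g z))) (p : ℕ) :
    Tendsto (fun n => iteratedDeriv p (f n) c) atTop (𝓝 (iteratedDeriv p g c)) := by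
  have hq {h : ℂ → ℂ} (hh : DiffContOnCl ℂ h (Metric.ball c R)) :
      iteratedDeriv p h c = (2 * Real.pi * I / p.factorial)⁻¹ •
        ∮ z in C(c, R), (1 / (z - c) ^ (p + 1)) • h z := by
    have : (2 * Real.pi * I / p.factorial : ℂ) ≠ 0 := by
      simp [Nat.factorial_ne_zero, Real.pi_ne_zero]
    rw [hh.circleIntegral_one_div_sub_center_pow_smul hR p, inv_smul_smul₀ this]
  have hsub : Metric.sphere c R ⊆ closure (Metric.ball c R) := by
    rw [closure_ball c hR.ne']; exact Metric.sphere_subset_closedBall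
  rw [hq hg]
  refine Tendsto.congr' (hf.mono fun n hn => (hq hn).symm) ?_
  refine Tendsto.const_smul ?_ _
  simp only [circleIntegral]
  have hmem (θ : ℝ) : circleMap c R θ ∈ Metric.sphere c R := circleMap_mem_sphere c hR.le θ
  refine intervalIntegral.tendsto_integral_filter_of_dominated_convergence
    (fun _ => R * (1 / R ^ (p + 1) * M)) ?_ ?_ ?_ ?_
  · filter_upwards [hf] with n hn
    refine Continuous.aestronglyMeasurable ?_
    have h1 : Continuous fun θ => f n (circleMap c R θ) :=
      hn.continuousOn.comp_continuous (continuous_circleMap c R) fun θ => hsub (hmem θ)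
    have h2 : Continuous fun θ => (1 / (circleMap c R θ - c) ^ (p + 1) : ℂ) := by
      refine continuous_const.div (((continuous_circleMap c R).sub continuous_const).pow _) ?_
      intro θ
      exact pow_ne_zero _ (sub_ne_zero.2 (circleMap_ne_center hR.ne'))
    have h3 : Continuous (deriv (circleMap c R)) := by
      have : deriv (circleMap c R) = fun θ => circleMap 0 R θ * I := by
        ext θ; exact deriv_circleMap c R θ
      rw [this]
      exact (continuous_circleMap 0 R).mul continuous_const
    exact h3.smul (h2.smul h1)
  · filter_upwards [hM] with n hn
    refine Eventually.of_forall fun θ _ => ?_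
    rw [norm_smul, norm_smul, deriv_circleMap]
    have h1 : ‖circleMap 0 R θ * I‖ = R := by simp [abs_of_pos hR]
    have h2 : ‖(1 / (circleMap c R θ - c) ^ (p + 1) : ℂ)‖ = 1 / R ^ (p + 1) := by
      simp [abs_of_pos hR]
    rw [h1, h2]
    gcongr
    exact hn _ (hmem θ)
  · exact intervalIntegrable_const
  · refine Eventually.of_forall fun θ _ => ?_
    exact ((hlim _ (hmem θ)).const_smul _).const_smul _

/-- Holomorphy of an integral depending holomorphically on a parameter, with a dominated
integrand. -/
theorem differentiableOn_integral_of_dominated {α : Type*} [MeasurableSpace α] {μ : Measure α}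
    {F : ℂ → α → ℂ} {U : Set ℂ} (hU : IsOpen U) {bound : α → ℝ}
    (hmeas : ∀ z ∈ U, AEStronglyMeasurable (F z) μ)
    (hdiff : ∀ᵐ a ∂μ, DifferentiableOn ℂ (fun z => F z a) U)
    (hbound : ∀ᵐ a ∂μ, ∀ z ∈ U, ‖F z a‖ ≤ bound a) (hint : Integrable bound μ) :
    DifferentiableOn ℂ (fun z => ∫ a, F z a ∂μ) U := by
  intro z₀ hz₀
  obtain ⟨ε, hε, hball⟩ := Metric.isOpen_iff.1 hU z₀ hz₀
  have hnhds : Metric.ball z₀ (ε / 2) ∈ 𝓝 z₀ := Metric.ball_mem_nhds _ (half_pos hε)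
  have hev : ∀ᶠ z in 𝓝 z₀, z ∈ U := hU.mem_nhds hz₀
  have key := hasDerivAt_integral_of_dominated_loc_of_deriv_le (μ := μ) (F := F)
    (F' := fun z a => deriv (fun z => F z a) z) (bound := fun a => bound a / (ε / 4)) hnhds
    (hev.mono fun z hz => hmeas z hz)
    (hint.mono' (hmeas z₀ hz₀) (hbound.mono fun a ha => ha z₀ hz₀)) ?_ ?_
    (hint.div_const _) ?_
  · exact key.2.differentiableAt.differentiableWithinAt
  · obtain ⟨u, hu, hu0⟩ : ∃ u : ℕ → ℂ, (∀ n, u n ∈ Metric.ball (0 : ℂ) ε ∧ u n ≠ 0) ∧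
        Tendsto u atTop (𝓝[≠] 0) := by
      have hne : (𝓝[≠] (0 : ℂ)).NeBot := inferInstance
      obtain ⟨u, hu⟩ := exists_seq_tendsto (𝓝[≠] (0 : ℂ))
      have h1 : ∀ᶠ n in atTop, u n ∈ Metric.ball (0 : ℂ) ε ∧ u n ≠ 0 := by
        have h2 : ∀ᶠ y in 𝓝[≠] (0 : ℂ), y ∈ Metric.ball (0 : ℂ) ε ∧ y ≠ 0 :=
          Filter.inter_mem (mem_nhdsWithin_of_mem_nhds (Metric.ball_mem_nhds (0 : ℂ) hε))
            self_mem_nhdsWithin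
        exact hu.eventually h2
      obtain ⟨N, hN⟩ := eventually_atTop.1 h1
      exact ⟨fun n => u (n + N), fun n => hN _ (Nat.le_add_left _ _),
        hu.comp (tendsto_add_atTop_nat N)⟩
    refine aestronglyMeasurable_of_tendsto_ae atTop
      (f := fun n a => (u n)⁻¹ • (F (z₀ + u n) a - F z₀ a)) (fun n => ?_) ?_
    · have : z₀ + u n ∈ U := hball (by simpa using (hu n).1)
      exact ((hmeas _ this).sub (hmeas _ hz₀)).const_smul (u n)⁻¹
    · filter_upwards [hdiff] with a ha
      have := ((ha z₀ hz₀).differentiableAt hev).hasDerivAt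
      exact (hasDerivAt_iff_tendsto_slope_zero.1 this).comp hu0
  · filter_upwards [hdiff, hbound] with a ha hb z hz
    have hsub : Metric.closedBall z (ε / 4) ⊆ U := by
      intro w hw
      apply hball
      simp only [Metric.mem_ball, Metric.mem_closedBall] at *
      linarith [dist_triangle w z z₀]
    refine norm_deriv_le_of_forall_mem_sphere_norm_le (by positivity) ?_
      fun w hw => hb w (hsub (Metric.sphere_subset_closedBall hw))
    refine DifferentiableOn.diffContOnCl ?_
    rw [closure_ball _ (by positivity)]
    exact ha.mono hsub
  · filter_upwards [hdiff] with a ha z hz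
    have hzU : z ∈ U := hball (Metric.ball_subset_ball (by linarith) hz)
    exact ((ha z hzU).differentiableAt (hU.mem_nhds hzU)).hasDerivAt

/-- Iterated derivatives on the half line of a function with a holomorphic extension. -/
theorem iteratedDerivWithin_eq_re_of_differentiableOn {U : Set ℂ} (hU : IsOpen U)
    (hpos : ∀ t : ℝ, 0 < t → (t : ℂ) ∈ U) {H : ℂ → ℂ} (hH : DifferentiableOn ℂ H U) {F : ℝ → ℝ}
    (hF : ∀ t : ℝ, 0 < t → F t = (H t).re) (p : ℕ) {t : ℝ} (ht : 0 < t) :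
    iteratedDerivWithin p F (Ioi 0) t = (iteratedDeriv p H t).re := by
  induction p generalizing t with
  | zero => simp [hF t ht]
  | succ p ih =>
    rw [iteratedDerivWithin_succ, iteratedDeriv_succ]
    have hd : HasDerivAt (iteratedDeriv p H) (deriv (iteratedDeriv p H) t) (t : ℂ) := by
      have han := (hH.analyticOnNhd hU) t (hpos t ht)
      exact (han.iterated_deriv p |>.differentiableAt.hasDerivAt : HasDerivAt (deriv^[p] H) _ _)
        |> fun h => by simpa [iteratedDeriv_eq_iterate] using h
    have h1 := (hd.real_of_complex).hasDerivWithinAt (s := Ioi 0)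
    have h2 : HasDerivWithinAt (iteratedDerivWithin p F (Ioi 0))
        (deriv (iteratedDeriv p H) t).re (Ioi 0) t :=
      h1.congr (fun x hx => ih hx) (ih ht)
    exact h2.derivWithin (isOpen_Ioi.uniqueDiffWithinAt ht)

/-- Smoothness on the half line of a function with a holomorphic extension. -/
theorem contDiffOn_Ioi_of_differentiableOn {U : Set ℂ} (hU : IsOpen U)
    (hpos : ∀ t : ℝ, 0 < t → (t : ℂ) ∈ U) {H : ℂ → ℂ} (hH : DifferentiableOn ℂ H U) {F : ℝ → ℝ}
    (hF : ∀ t : ℝ, 0 < t → F t = (H t).re) (n : ℕ) : ContDiffOn ℝ n F (Ioi 0) := by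
  intro t ht
  have h1 : ContDiffAt ℂ n H t := ((hH.analyticOnNhd hU) t (hpos t ht)).contDiffAt
  exact (h1.real_of_complex.contDiffWithinAt).congr (fun x hx => hF x hx) (hF t ht)

/-- The `m`-th term of the Fredholm series of a complex kernel `k` on `S` with weight `ρ`. -/
def fredholmTerm (S : Set ℝ) (ρ : ℝ → ℝ) (k : ℝ → ℝ → ℂ) (m : ℕ) : ℂ :=
  ((-1 : ℂ) ^ m / m.factorial) *
    ∫ x : Fin m → ℝ in Set.univ.pi fun _ => S,
      ((∏ i, ρ (x i) : ℝ) : ℂ) * (Matrix.of fun i j => k (x i) (x j)).det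

/-- The Fredholm determinant of a complex kernel `k` on `S` with weight `ρ`. -/
def fredholmSeries (S : Set ℝ) (ρ : ℝ → ℝ) (k : ℝ → ℝ → ℂ) : ℂ :=
  1 + ∑' m : ℕ, fredholmTerm S ρ k (m + 1)

/-- A summable majorant of the Fredholm series. -/
def fredholmMajorant (C : ℝ) (m : ℕ) : ℝ :=
  (2 * Real.exp 1 * C ^ 2) ^ m / m.factorial + (1 / 2) ^ m

theorem summable_fredholmMajorant (C : ℝ) : Summable fun m => fredholmMajorant C (m + 1) :=
  (summable_nat_add_iff 1).2 <|
    (Real.summable_pow_div_factorial _).add summable_geometric_two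

theorem norm_fredholm_integrand_le {S : Set ℝ} {ρ : ℝ → ℝ} (hρ : ∀ u ∈ S, 0 ≤ ρ u)
    {k : ℝ → ℝ → ℂ} {M : ℝ} (hM : ∀ u ∈ S, ∀ v ∈ S, ‖k u v‖ ≤ M) {m : ℕ} {x : Fin m → ℝ}
    (hx : x ∈ Set.univ.pi fun _ => S) :
    ‖((∏ i, ρ (x i) : ℝ) : ℂ) * (Matrix.of fun i j => k (x i) (x j)).det‖ ≤
      (∏ i, ρ (x i)) * Real.sqrt ((m * M ^ 2) ^ m) := by
  have hx' : ∀ i, x i ∈ S := fun i => hx i (mem_univ i)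
  have hp : 0 ≤ ∏ i, ρ (x i) := Finset.prod_nonneg fun i _ => hρ _ (hx' i)
  rw [norm_mul, Complex.norm_real, Real.norm_of_nonneg hp]
  gcongr
  refine Real.le_sqrt_of_sq_le ?_
  have := norm_det_sq_le_of_entry_le (Matrix.of fun i j => k (x i) (x j)) (M := M)
    fun i j => hM _ (hx' i) _ (hx' j)
  rwa [Fintype.card_fin] at this

theorem integrableOn_pi_prod {S : Set ℝ} {ρ : ℝ → ℝ} (hρi : IntegrableOn ρ S) (m : ℕ) :
    IntegrableOn (fun x : Fin m → ℝ => ∏ i, ρ (x i)) (Set.univ.pi fun _ => S) := by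
  rw [IntegrableOn, volume_pi, Measure.restrict_pi_pi]
  exact Integrable.fintype_prod fun _ => hρi

theorem integral_pi_prod (S : Set ℝ) (ρ : ℝ → ℝ) (m : ℕ) :
    ∫ x : Fin m → ℝ in Set.univ.pi fun _ => S, ∏ i, ρ (x i) = (∫ u in S, ρ u) ^ m := by
  rw [volume_pi, Measure.restrict_pi_pi, integral_fintype_prod_eq_pow, Fintype.card_fin]

theorem norm_fredholmTerm_le {S : Set ℝ} (hS : MeasurableSet S) {ρ : ℝ → ℝ}
    (hρ : ∀ u ∈ S, 0 ≤ ρ u) (hρi : IntegrableOn ρ S) {k : ℝ → ℝ → ℂ} {M : ℝ}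
    (hM : ∀ u ∈ S, ∀ v ∈ S, ‖k u v‖ ≤ M) (m : ℕ) :
    ‖fredholmTerm S ρ k m‖ ≤ fredholmMajorant (M * ∫ u in S, ρ u) m := by
  have hI : 0 ≤ ∫ u in S, ρ u := setIntegral_nonneg hS hρ
  have hSm : MeasurableSet (Set.univ.pi fun _ : Fin m => S) :=
    MeasurableSet.univ_pi fun _ => hS
  have h1 : ‖∫ x : Fin m → ℝ in Set.univ.pi fun _ => S,
      ((∏ i, ρ (x i) : ℝ) : ℂ) * (Matrix.of fun i j => k (x i) (x j)).det‖ ≤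
      (∫ u in S, ρ u) ^ m * Real.sqrt ((m * M ^ 2) ^ m) := by
    rw [← integral_pi_prod, ← integral_mul_const]
    refine norm_integral_le_of_norm_le ((integrableOn_pi_prod hρi m).mul_const _) ?_
    filter_upwards [ae_restrict_mem hSm] with x hx
    exact norm_fredholm_integrand_le hρ hM hx
  refine le_trans ?_ (sqrt_card_pow_div_factorial_le m (M * ∫ u in S, ρ u))
  rw [fredholmTerm, norm_mul, norm_div, norm_pow, norm_neg, norm_one, one_pow,
    Complex.norm_natCast, one_div, inv_mul_eq_div]
  gcongr
  refine h1.trans (le_of_eq ?_)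
  rw [show ((m : ℝ) * (M * ∫ u in S, ρ u) ^ 2) ^ m
      = ((∫ u in S, ρ u) ^ m) ^ 2 * ((m : ℝ) * M ^ 2) ^ m by
    rw [← pow_mul, mul_comm m 2, pow_mul, ← mul_pow]; ring,
    Real.sqrt_mul (sq_nonneg _), Real.sqrt_sq (pow_nonneg hI m)]

theorem aestronglyMeasurable_fredholm_integrand {S : Set ℝ} {ρ : ℝ → ℝ} (hρi : IntegrableOn ρ S)
    {k : ℝ → ℝ → ℂ} (hk : Measurable fun p : ℝ × ℝ => k p.1 p.2) (m : ℕ) :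
    AEStronglyMeasurable (fun x : Fin m → ℝ =>
      ((∏ i, ρ (x i) : ℝ) : ℂ) * (Matrix.of fun i j => k (x i) (x j)).det)
      (volume.restrict (Set.univ.pi fun _ => S)) := by
  refine AEStronglyMeasurable.mul ?_ (Measurable.aestronglyMeasurable ?_)
  · exact Complex.continuous_ofReal.comp_aestronglyMeasurable
      (integrableOn_pi_prod hρi m).aestronglyMeasurable
  · simp only [Matrix.det_apply, Matrix.of_apply]
    refine Finset.measurable_sum _ fun σ _ => Measurable.const_smul ?_ _
    refine Finset.measurable_prod _ fun i _ => ?_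
    exact hk.comp (f := fun x : Fin m → ℝ => (x (σ i), x i))
      ((measurable_pi_apply _).prodMk (measurable_pi_apply _))

/-- Holomorphy of the Fredholm determinant of a holomorphic family of kernels. -/
theorem differentiableOn_fredholmSeries {S : Set ℝ} (hS : MeasurableSet S) {ρ : ℝ → ℝ}
    (hρ : ∀ u ∈ S, 0 ≤ ρ u) (hρi : IntegrableOn ρ S) {U : Set ℂ} (hU : IsOpen U)
    {k : ℂ → ℝ → ℝ → ℂ} (hmeas : ∀ z ∈ U, Measurable fun p : ℝ × ℝ => k z p.1 p.2)
    (hdiff : ∀ u ∈ S, ∀ v ∈ S, DifferentiableOn ℂ (fun z => k z u v) U)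
    (hbdd : ∀ z ∈ U, ∃ M, ∀ᶠ z' in 𝓝 z, ∀ u ∈ S, ∀ v ∈ S, ‖k z' u v‖ ≤ M) :
    DifferentiableOn ℂ (fun z => fredholmSeries S ρ (k z)) U := by
  intro z₀ hz₀
  obtain ⟨M, hM⟩ := hbdd z₀ hz₀
  obtain ⟨V, hV, hVo, hzV⟩ := eventually_nhds_iff.1 hM
  have hUV : IsOpen (U ∩ V) := hU.inter hVo
  suffices h : DifferentiableOn ℂ (fun z => fredholmSeries S ρ (k z)) (U ∩ V) from
    (h.differentiableAt (hUV.mem_nhds ⟨hz₀, hzV⟩)).differentiableWithinAt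
  refine (differentiableOn_const _).add ?_
  refine differentiableOn_tsum_of_summable_norm
    (summable_fredholmMajorant (M * ∫ u in S, ρ u)) (fun m => ?_) hUV
    fun m z hz => norm_fredholmTerm_le hS hρ hρi (hV z hz.2) _
  have hSm : MeasurableSet (Set.univ.pi fun _ : Fin (m + 1) => S) :=
    MeasurableSet.univ_pi fun _ => hS
  refine (differentiableOn_const _).mul ?_
  refine differentiableOn_integral_of_dominated hUV
    (fun z hz => aestronglyMeasurable_fredholm_integrand hρi (hmeas z hz.1) _) ?_
    (bound := fun x => (∏ i, ρ (x i)) * Real.sqrt (((m + 1 : ℕ) * M ^ 2) ^ (m + 1))) ?_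
    ((integrableOn_pi_prod hρi (m + 1)).mul_const _)
  · filter_upwards [ae_restrict_mem hSm] with x hx
    refine (differentiableOn_const _).mul ?_
    simp only [Matrix.det_apply, Matrix.of_apply]
    refine DifferentiableOn.fun_sum fun σ _ => DifferentiableOn.const_smul ?_ _
    refine DifferentiableOn.fun_finsetProd fun i _ => ?_
    exact (hdiff _ (hx _ (mem_univ _)) _ (hx _ (mem_univ _))).mono inter_subset_left
  · filter_upwards [ae_restrict_mem hSm] with x hx z hz
    exact norm_fredholm_integrand_le hρ (hV z hz.2) hx

/-- Pointwise convergence of Fredholm determinants of bounded convergent kernels. -/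
theorem tendsto_fredholmSeries {S : Set ℝ} (hS : MeasurableSet S) {ρ : ℝ → ℝ}
    (hρ : ∀ u ∈ S, 0 ≤ ρ u) (hρi : IntegrableOn ρ S) {k : ℕ → ℝ → ℝ → ℂ} {k₀ : ℝ → ℝ → ℂ} {M : ℝ}
    (hM : ∀ᶠ n in atTop, ∀ u ∈ S, ∀ v ∈ S, ‖k n u v‖ ≤ M)
    (hmeas : ∀ᶠ n in atTop, Measurable fun p : ℝ × ℝ => k n p.1 p.2)
    (hlim : ∀ u ∈ S, ∀ v ∈ S, Tendsto (fun n => k n u v) atTop (𝓝 (k₀ u v))) :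
    Tendsto (fun n => fredholmSeries S ρ (k n)) atTop (𝓝 (fredholmSeries S ρ k₀)) := by
  refine tendsto_const_nhds.add ?_
  refine tendsto_tsum_of_dominated_convergence
    (summable_fredholmMajorant (M * ∫ u in S, ρ u)) (fun m => ?_)
    (hM.mono fun n hn m => norm_fredholmTerm_le hS hρ hρi hn _)
  have hSm : MeasurableSet (Set.univ.pi fun _ : Fin (m + 1) => S) :=
    MeasurableSet.univ_pi fun _ => hS
  refine Tendsto.const_mul _ ?_
  refine tendsto_integral_filter_of_dominated_convergence
    (fun x => (∏ i, ρ (x i)) * Real.sqrt (((m + 1 : ℕ) * M ^ 2) ^ (m + 1)))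
    (hmeas.mono fun n hn => aestronglyMeasurable_fredholm_integrand hρi hn _)
    (hM.mono fun n hn => ?_) ((integrableOn_pi_prod hρi (m + 1)).mul_const _) ?_
  · filter_upwards [ae_restrict_mem hSm] with x hx
    exact norm_fredholm_integrand_le hρ hn hx
  · filter_upwards [ae_restrict_mem hSm] with x hx
    refine Tendsto.const_mul _ ?_
    simp only [Matrix.det_apply, Matrix.of_apply]
    refine tendsto_finsetSum _ fun σ _ => Tendsto.const_smul ?_ _
    refine tendsto_finsetProd _ fun i _ => ?_
    exact hlim _ (hx _ (mem_univ _)) _ (hx _ (mem_univ _))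

theorem norm_fredholmSeries_le {S : Set ℝ} (hS : MeasurableSet S) {ρ : ℝ → ℝ}
    (hρ : ∀ u ∈ S, 0 ≤ ρ u) (hρi : IntegrableOn ρ S) {k : ℝ → ℝ → ℂ} {M : ℝ}
    (hM : ∀ u ∈ S, ∀ v ∈ S, ‖k u v‖ ≤ M) :
    ‖fredholmSeries S ρ k‖ ≤
      1 + ∑' m : ℕ, fredholmMajorant (M * ∫ u in S, ρ u) (m + 1) := by
  refine (norm_add_le _ _).trans ?_
  rw [norm_one]
  gcongr
  exact tsum_of_norm_bounded (summable_fredholmMajorant _).hasSum fun m =>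
    norm_fredholmTerm_le hS hρ hρi hM _

/-- Convergence of all derivatives of Fredholm determinants of holomorphic families of kernels
that converge pointwise and boundedly. -/
theorem tendsto_iteratedDeriv_fredholmSeries {S : Set ℝ} (hS : MeasurableSet S) {ρ : ℝ → ℝ}
    (hρ : ∀ u ∈ S, 0 ≤ ρ u) (hρi : IntegrableOn ρ S) {U : Set ℂ} (hU : IsOpen U)
    {k : ℕ → ℂ → ℝ → ℝ → ℂ} {k₀ : ℂ → ℝ → ℝ → ℂ}
    (hmeas : ∀ᶠ n in atTop, ∀ z ∈ U, Measurable fun p : ℝ × ℝ => k n z p.1 p.2)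
    (hhol : ∀ᶠ n in atTop, DifferentiableOn ℂ (fun z => fredholmSeries S ρ (k n z)) U)
    (hhol₀ : DifferentiableOn ℂ (fun z => fredholmSeries S ρ (k₀ z)) U)
    (hunif : ∀ z ∈ U, ∃ M, ∃ r > 0, ∀ᶠ n in atTop, ∀ z' ∈ Metric.ball z r,
      ∀ u ∈ S, ∀ v ∈ S, ‖k n z' u v‖ ≤ M)
    (hlim : ∀ z ∈ U, ∀ u ∈ S, ∀ v ∈ S, Tendsto (fun n => k n z u v) atTop (𝓝 (k₀ z u v)))
    (p : ℕ) {z : ℂ} (hz : z ∈ U) :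
    Tendsto (fun n => iteratedDeriv p (fun z => fredholmSeries S ρ (k n z)) z) atTop
      (𝓝 (iteratedDeriv p (fun z => fredholmSeries S ρ (k₀ z)) z)) := by
  obtain ⟨M, r, hr, hM⟩ := hunif z hz
  obtain ⟨ε, hε, hball⟩ := Metric.isOpen_iff.1 hU z hz
  have hR : 0 < min r ε / 2 := by positivity
  have hsub : Metric.closedBall z (min r ε / 2) ⊆ Metric.ball z r ∩ U := fun w hw => by
    have h1 : dist w z ≤ min r ε / 2 := hw
    have h2 := min_le_left r ε
    have h3 := min_le_right r ε
    have h4 : 0 < min r ε := by positivity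
    exact ⟨by rw [Metric.mem_ball]; linarith, hball (by rw [Metric.mem_ball]; linarith)⟩
  have hcl {f : ℂ → ℂ} (hf : DifferentiableOn ℂ f U) :
      DiffContOnCl ℂ f (Metric.ball z (min r ε / 2)) := by
    refine DifferentiableOn.diffContOnCl ?_
    rw [closure_ball _ hR.ne']
    exact hf.mono fun w hw => (hsub hw).2
  refine tendsto_iteratedDeriv_of_tendsto_of_bounded hR (hhol.mono fun n hn => hcl hn) (hcl hhol₀)
    (M := 1 + ∑' m : ℕ, fredholmMajorant (M * ∫ u in S, ρ u) (m + 1))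
    (hM.mono fun n hn w hw => norm_fredholmSeries_le hS hρ hρi
      (hn w (hsub (Metric.sphere_subset_closedBall hw)).1)) (fun w hw => ?_) p
  have hw' := hsub (Metric.sphere_subset_closedBall hw)
  exact tendsto_fredholmSeries hS hρ hρi (hM.mono fun n hn => hn w hw'.1)
    (hmeas.mono fun n hn => hn w hw'.2) (hlim w hw'.2)

/-- The open horizontal strip `|Im z| < 1`. -/
def unitStrip : Set ℂ := {z | |z.im| < 1}

theorem isOpen_unitStrip : IsOpen unitStrip :=
  isOpen_lt (continuous_abs.comp Complex.continuous_im) continuous_const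

/-- Eventual uniform boundedness on bounded parts of the substrip `|Im z| ≤ δ`. -/
def StripBounded (δ : ℝ) (F : ℕ → ℂ → ℂ) : Prop :=
  ∀ R : ℝ, ∃ M : ℝ, ∀ᶠ n in atTop, ∀ z : ℂ, ‖z‖ ≤ R → |z.im| ≤ δ → ‖F n z‖ ≤ M

theorem StripBounded.mono {δ δ' : ℝ} {F : ℕ → ℂ → ℂ} (h : StripBounded δ F) (hδ : δ' ≤ δ) :
    StripBounded δ' F := fun R => (h R).imp fun _ hM => hM.mono fun _ hn z hz hz' =>
  hn z hz (hz'.trans hδ)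

theorem stripBounded_const {f : ℂ → ℂ} (hf : DifferentiableOn ℂ f unitStrip) :
    StripBounded (3 / 4) fun _ => f := by
  intro R
  have hK : IsCompact (Metric.closedBall (0 : ℂ) R ∩ {z | |z.im| ≤ 3 / 4}) :=
    (isCompact_closedBall _ _).inter_right
      (isClosed_le (continuous_abs.comp Complex.continuous_im) continuous_const)
  have hsub : Metric.closedBall (0 : ℂ) R ∩ {z | |z.im| ≤ 3 / 4} ⊆ unitStrip :=
    fun z hz => lt_of_le_of_lt (show |z.im| ≤ 3 / 4 from hz.2) (by norm_num)
  obtain ⟨M, hM⟩ := hK.exists_bound_of_continuousOn (hf.continuousOn.mono hsub)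
  exact ⟨M, Eventually.of_forall fun _ z hz hz' => hM z ⟨by simpa using hz, hz'⟩⟩

theorem closedBall_quarter_subset {z : ℂ} (hz : |z.im| ≤ 1 / 2) {w : ℂ}
    (hw : w ∈ Metric.closedBall z (1 / 4)) : ‖w‖ ≤ ‖z‖ + 1 ∧ |w.im| ≤ 3 / 4 := by
  have h1 : ‖w - z‖ ≤ 1 / 4 := by simpa [dist_eq_norm] using hw
  constructor
  · have := norm_add_le (w - z) z
    rw [sub_add_cancel] at this
    linarith
  · have h2 := (Complex.abs_im_le_norm (w - z)).trans h1
    have h3 := abs_add_le (w - z).im z.im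
    rw [← Complex.add_im, sub_add_cancel] at h3
    linarith

theorem diffContOnCl_quarter {f : ℂ → ℂ} (hf : DifferentiableOn ℂ f unitStrip) {z : ℂ}
    (hz : |z.im| ≤ 1 / 2) : DiffContOnCl ℂ f (Metric.ball z (1 / 4)) := by
  refine DifferentiableOn.diffContOnCl ?_
  rw [closure_ball _ (by norm_num)]
  exact hf.mono fun w hw => lt_of_le_of_lt (closedBall_quarter_subset hz hw).2 (by norm_num)

theorem StripBounded.deriv {F : ℕ → ℂ → ℂ} (h : StripBounded (3 / 4) F)
    (hF : ∀ᶠ n in atTop, DifferentiableOn ℂ (F n) unitStrip) :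
    StripBounded (1 / 2) fun n => deriv (F n) := by
  intro R
  obtain ⟨M, hM⟩ := h (R + 1)
  refine ⟨M / (1 / 4), ?_⟩
  filter_upwards [hM, hF] with n hn hd z hz hz'
  refine norm_deriv_le_of_forall_mem_sphere_norm_le (by norm_num) (diffContOnCl_quarter hd hz')
    fun w hw => ?_
  obtain ⟨h1, h2⟩ := closedBall_quarter_subset hz' (Metric.sphere_subset_closedBall hw)
  exact hn w (by linarith) h2

theorem StripBounded.tendsto_deriv {F : ℕ → ℂ → ℂ} {f : ℂ → ℂ} (h : StripBounded (3 / 4) F)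
    (hF : ∀ᶠ n in atTop, DifferentiableOn ℂ (F n) unitStrip) (hf : DifferentiableOn ℂ f unitStrip)
    (hlim : ∀ z ∈ unitStrip, Tendsto (fun n => F n z) atTop (𝓝 (f z))) {z : ℂ}
    (hz : |z.im| ≤ 1 / 2) : Tendsto (fun n => _root_.deriv (F n) z) atTop (𝓝 (_root_.deriv f z)) := by
  obtain ⟨M, hM⟩ := h (‖z‖ + 1)
  simp only [← iteratedDeriv_one]
  refine tendsto_iteratedDeriv_of_tendsto_of_bounded (R := 1 / 4) (M := M) (by norm_num)
    (hF.mono fun n hn => diffContOnCl_quarter hn hz) (diffContOnCl_quarter hf hz)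
    (hM.mono fun n hn w hw => ?_) (fun w hw => hlim w ?_) 1
  · obtain ⟨h1, h2⟩ := closedBall_quarter_subset hz (Metric.sphere_subset_closedBall hw)
    exact hn w h1 h2
  · exact lt_of_le_of_lt
      (closedBall_quarter_subset hz (Metric.sphere_subset_closedBall hw)).2 (by norm_num)

/-- The divided Wronskian `(f(u)g(v) − g(u)f(v))/(v − u)`, extended to the diagonal. -/
def dividedWronskian (f g : ℂ → ℂ) (u v : ℂ) : ℂ :=
  if u = v then f u * deriv g u - g u * deriv f u else (f u * g v - g u * f v) / (v - u)

theorem measurable_dividedWronskian {f g : ℂ → ℂ} (hf : Measurable f) (hg : Measurable g) :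
    Measurable fun p : ℂ × ℂ => dividedWronskian f g p.1 p.2 := by
  unfold dividedWronskian
  refine Measurable.ite (measurableSet_eq_fun measurable_fst measurable_snd) ?_ ?_
  · exact ((hf.comp measurable_fst).mul ((measurable_deriv g).comp measurable_fst)).sub
      ((hg.comp measurable_fst).mul ((measurable_deriv f).comp measurable_fst))
  · exact (((hf.comp measurable_fst).mul (hg.comp measurable_snd)).sub
      ((hg.comp measurable_fst).mul (hf.comp measurable_snd))).div
      (measurable_snd.sub measurable_fst)

theorem norm_dividedWronskian_le {f g : ℂ → ℂ} {B : Set ℂ} (hB : Convex ℝ B)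
    (hf : ∀ z ∈ B, DifferentiableAt ℂ f z) (hg : ∀ z ∈ B, DifferentiableAt ℂ g z) {M : ℝ}
    (hfM : ∀ z ∈ B, ‖f z‖ ≤ M) (hgM : ∀ z ∈ B, ‖g z‖ ≤ M) (hfM' : ∀ z ∈ B, ‖deriv f z‖ ≤ M)
    (hgM' : ∀ z ∈ B, ‖deriv g z‖ ≤ M) {u v : ℂ} (hu : u ∈ B) (hv : v ∈ B) :
    ‖dividedWronskian f g u v‖ ≤ M * M + M * M := by
  have hM : 0 ≤ M := (norm_nonneg _).trans (hfM u hu)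
  unfold dividedWronskian
  split_ifs with h
  · refine (norm_sub_le _ _).trans ?_
    rw [norm_mul, norm_mul]
    gcongr
    exacts [hfM u hu, hgM' u hu, hgM u hu, hfM' u hu]
  · have h1 := hB.norm_image_sub_le_of_norm_deriv_le hf hfM' hu hv
    have h2 := hB.norm_image_sub_le_of_norm_deriv_le hg hgM' hu hv
    have h3 : 0 < ‖v - u‖ := norm_pos_iff.2 (sub_ne_zero.2 (Ne.symm h))
    rw [norm_div, div_le_iff₀ h3,
      show f u * g v - g u * f v = f u * (g v - g u) - g u * (f v - f u) by ring]
    refine (norm_sub_le _ _).trans ?_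
    rw [norm_mul, norm_mul]
    calc ‖f u‖ * ‖g v - g u‖ + ‖g u‖ * ‖f v - f u‖
        ≤ M * (M * ‖v - u‖) + M * (M * ‖v - u‖) := by
          gcongr
          exacts [hfM u hu, hgM u hu]
      _ = _ := by ring

theorem stripBounded_dividedWronskian {F G : ℕ → ℂ → ℂ} (hFb : StripBounded (3 / 4) F)
    (hGb : StripBounded (3 / 4) G) (hF : ∀ᶠ n in atTop, DifferentiableOn ℂ (F n) unitStrip)
    (hG : ∀ᶠ n in atTop, DifferentiableOn ℂ (G n) unitStrip) (R : ℝ) :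
    ∃ M, ∀ᶠ n in atTop, ∀ u v : ℂ, ‖u‖ ≤ R → |u.im| ≤ 1 / 2 → ‖v‖ ≤ R → |v.im| ≤ 1 / 2 →
      ‖dividedWronskian (F n) (G n) u v‖ ≤ M := by
  obtain ⟨M₁, h₁⟩ := hFb.mono (by norm_num : (1 / 2 : ℝ) ≤ 3 / 4) R
  obtain ⟨M₂, h₂⟩ := hGb.mono (by norm_num : (1 / 2 : ℝ) ≤ 3 / 4) R
  obtain ⟨M₃, h₃⟩ := hFb.deriv hF R
  obtain ⟨M₄, h₄⟩ := hGb.deriv hG R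
  set M := max (max M₁ M₂) (max M₃ M₄) with hM
  have l₁ : M₁ ≤ M := (le_max_left _ _).trans (le_max_left _ _)
  have l₂ : M₂ ≤ M := (le_max_right _ _).trans (le_max_left _ _)
  have l₃ : M₃ ≤ M := (le_max_left _ _).trans (le_max_right _ _)
  have l₄ : M₄ ≤ M := (le_max_right _ _).trans (le_max_right _ _)
  refine ⟨M * M + M * M, ?_⟩
  filter_upwards [h₁, h₂, h₃, h₄, hF, hG] with n b₁ b₂ b₃ b₄ dF dG u v hu hu' hv hv'
  set B : Set ℂ := Metric.closedBall 0 R ∩ {z | |z.im| ≤ 1 / 2} with hB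
  have hconv : Convex ℝ B := by
    refine (convex_closedBall _ _).inter ?_
    have : {z : ℂ | |z.im| ≤ 1 / 2} = Complex.imLm ⁻¹' (Icc (-(1 / 2)) (1 / 2)) := by
      ext z; simp [abs_le]
    rw [this]
    exact (convex_Icc _ _).is_linear_preimage Complex.imLm.isLinear
  have hBs (z : ℂ) (hz : z ∈ B) : ‖z‖ ≤ R ∧ |z.im| ≤ 1 / 2 := ⟨by simpa using hz.1, hz.2⟩
  have hBd {f : ℂ → ℂ} (hf : DifferentiableOn ℂ f unitStrip) (z : ℂ) (hz : z ∈ B) :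
      DifferentiableAt ℂ f z :=
    hf.differentiableAt (isOpen_unitStrip.mem_nhds (lt_of_le_of_lt (hBs z hz).2 (by norm_num)))
  exact norm_dividedWronskian_le hconv (hBd dF) (hBd dG)
    (fun z hz => (b₁ z (hBs z hz).1 (hBs z hz).2).trans l₁)
    (fun z hz => (b₂ z (hBs z hz).1 (hBs z hz).2).trans l₂)
    (fun z hz => (b₃ z (hBs z hz).1 (hBs z hz).2).trans l₃)
    (fun z hz => (b₄ z (hBs z hz).1 (hBs z hz).2).trans l₄)
    ⟨by simpa using hu, hu'⟩ ⟨by simpa using hv, hv'⟩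

theorem tendsto_dividedWronskian {F G : ℕ → ℂ → ℂ} {f g : ℂ → ℂ} (hFb : StripBounded (3 / 4) F)
    (hGb : StripBounded (3 / 4) G) (hF : ∀ᶠ n in atTop, DifferentiableOn ℂ (F n) unitStrip)
    (hG : ∀ᶠ n in atTop, DifferentiableOn ℂ (G n) unitStrip)
    (hf : DifferentiableOn ℂ f unitStrip) (hg : DifferentiableOn ℂ g unitStrip)
    (hFl : ∀ z ∈ unitStrip, Tendsto (fun n => F n z) atTop (𝓝 (f z)))
    (hGl : ∀ z ∈ unitStrip, Tendsto (fun n => G n z) atTop (𝓝 (g z)))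
    {u v : ℂ} (hu : |u.im| ≤ 1 / 2) (hv : |v.im| ≤ 1 / 2) :
    Tendsto (fun n => dividedWronskian (F n) (G n) u v) atTop (𝓝 (dividedWronskian f g u v)) := by
  have hu' : u ∈ unitStrip := lt_of_le_of_lt hu (by norm_num)
  have hv' : v ∈ unitStrip := lt_of_le_of_lt hv (by norm_num)
  unfold dividedWronskian
  split_ifs with h
  · exact ((hFl u hu').mul (hGb.tendsto_deriv hG hg hGl hu)).sub
      ((hGl u hu').mul (hFb.tendsto_deriv hF hf hFl hu))
  · exact (((hFl u hu').mul (hGl v hv')).sub ((hGl u hu').mul (hFl v hv'))).div_const _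

/-- The domain of the holomorphic extension of the Fredholm determinants. -/
def inverseStrip : Set ℂ := {z | 0 < z.re ∧ |(z⁻¹).im| < 1 / 2}

theorem isOpen_inverseStrip : IsOpen inverseStrip := by
  have h1 : IsOpen {z : ℂ | 0 < z.re} := isOpen_lt continuous_const Complex.continuous_re
  have h2 : ContinuousOn (fun z : ℂ => |(z⁻¹).im|) {z : ℂ | 0 < z.re} := by
    refine (continuous_abs.comp Complex.continuous_im).comp_continuousOn ?_
    refine continuousOn_inv₀.mono fun z hz h0 => ?_
    have hz' : 0 < z.re := hz
    rw [h0] at hz'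
    simp at hz'
  exact h2.isOpen_inter_preimage h1 isOpen_Iio

theorem ofReal_mem_inverseStrip {t : ℝ} (ht : 0 < t) : (t : ℂ) ∈ inverseStrip := by
  refine ⟨by simpa using ht, ?_⟩
  rw [← Complex.ofReal_inv, Complex.ofReal_im]
  norm_num

theorem conj_mem_inverseStrip {z : ℂ} (hz : z ∈ inverseStrip) :
    (starRingEnd ℂ) z ∈ inverseStrip := by
  refine ⟨by simpa using hz.1, ?_⟩
  rw [← map_inv₀, Complex.conj_im, abs_neg]
  exact hz.2

theorem ne_zero_of_mem_inverseStrip {z : ℂ} (hz : z ∈ inverseStrip) : z ≠ 0 := by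
  rintro rfl
  exact lt_irrefl _ hz.1

theorem abs_im_ofReal_div_le {z : ℂ} (hz : |(z⁻¹).im| < 1 / 2) {a : ℝ} (ha : a ∈ Ioo (0 : ℝ) 1) :
    |((a : ℂ) / z).im| ≤ 1 / 2 := by
  rw [div_eq_mul_inv, Complex.im_ofReal_mul, abs_mul, abs_of_pos ha.1]
  nlinarith [abs_nonneg (z⁻¹).im, ha.1, ha.2]

theorem norm_ofReal_div_le (z : ℂ) {a : ℝ} (ha : a ∈ Ioo (0 : ℝ) 1) :
    ‖(a : ℂ) / z‖ ≤ ‖z⁻¹‖ := by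
  rw [div_eq_mul_inv, norm_mul, Complex.norm_real, Real.norm_of_nonneg ha.1.le]
  exact mul_le_of_le_one_left (norm_nonneg _) ha.2.le

/-- The holomorphic extension of `t ↦ Re h(t)` from the real axis. -/
def reExtension (h : ℂ → ℂ) (z : ℂ) : ℂ := (h z + (starRingEnd ℂ) (h ((starRingEnd ℂ) z))) / 2

theorem reExtension_ofReal (h : ℂ → ℂ) (t : ℝ) : reExtension h t = ((h t).re : ℂ) := by
  rw [reExtension, Complex.conj_ofReal, Complex.add_conj]
  push_cast
  ring

/-- The kernel of the Fredholm determinant over `(t, ∞)` after the substitution `x = t / w`,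
as a holomorphic function of `t`. -/
def rescaledKernel (α : ℝ) (c : ℂ) (f g : ℂ → ℂ) (z : ℂ) (a b : ℝ) : ℂ :=
  z ^ (-(2 * α + 1) : ℂ) * reExtension (fun w => c * dividedWronskian f g (a / w) (b / w)) z

theorem measurable_rescaledKernel (α : ℝ) (c : ℂ) {f g : ℂ → ℂ} (hf : Measurable f)
    (hg : Measurable g) (z : ℂ) :
    Measurable fun p : ℝ × ℝ => rescaledKernel α c f g z p.1 p.2 := by
  have h (w : ℂ) : Measurable fun p : ℝ × ℝ => dividedWronskian f g (p.1 / w) (p.2 / w) :=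
    (measurable_dividedWronskian hf hg).comp
      (f := fun p : ℝ × ℝ => ((p.1 / w : ℂ), (p.2 / w : ℂ))) (by fun_prop)
  unfold rescaledKernel reExtension
  refine Measurable.const_mul (Measurable.div_const (((h z).const_mul c).add ?_) _) _
  exact Complex.continuous_conj.measurable.comp ((h _).const_mul c)

theorem differentiableOn_rescaledKernel (α : ℝ) (c : ℂ) {f g : ℂ → ℂ}
    (hf : DifferentiableOn ℂ f unitStrip) (hg : DifferentiableOn ℂ g unitStrip) {a b : ℝ}
    (ha : a ∈ Ioo (0 : ℝ) 1) (hb : b ∈ Ioo (0 : ℝ) 1) :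
    DifferentiableOn ℂ (fun z => rescaledKernel α c f g z a b) inverseStrip := by
  have hdiv {e : ℝ} {z : ℂ} (hz : z ∈ inverseStrip) :
      DifferentiableAt ℂ (fun w : ℂ => (e : ℂ) / w) z :=
    (differentiableAt_const _).div differentiableAt_id (ne_zero_of_mem_inverseStrip hz)
  have hcomp {h : ℂ → ℂ} (hh : DifferentiableOn ℂ h unitStrip) {e : ℝ} (he : e ∈ Ioo (0 : ℝ) 1)
      {z : ℂ} (hz : z ∈ inverseStrip) : DifferentiableAt ℂ (fun w : ℂ => h (e / w)) z := by
    have hmem : (e : ℂ) / z ∈ unitStrip :=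
      lt_of_le_of_lt (abs_im_ofReal_div_le hz.2 he) (by norm_num)
    exact (hh.differentiableAt (isOpen_unitStrip.mem_nhds hmem)).comp z (hdiv hz)
  have key {z : ℂ} (hz : z ∈ inverseStrip) :
      DifferentiableAt ℂ (fun w => c * dividedWronskian f g (a / w) (b / w)) z := by
    refine (differentiableAt_const _).mul ?_
    by_cases hab : a = b
    · subst hab
      simp only [dividedWronskian, if_true]
      exact ((hcomp hf ha hz).mul (hcomp (hg.deriv isOpen_unitStrip) ha hz)).sub
        ((hcomp hg ha hz).mul (hcomp (hf.deriv isOpen_unitStrip) ha hz))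
    · have hne {w : ℂ} (hw : w ∈ inverseStrip) : (a : ℂ) / w ≠ b / w := by
        have hw0 := ne_zero_of_mem_inverseStrip hw
        intro h
        rw [div_left_inj' hw0] at h
        exact hab (by exact_mod_cast h)
      have : (fun w : ℂ => dividedWronskian f g (a / w) (b / w)) =ᶠ[𝓝 z] fun w : ℂ =>
          (f (a / w) * g (b / w) - g (a / w) * f (b / w)) / (b / w - a / w) := by
        filter_upwards [isOpen_inverseStrip.mem_nhds hz] with w hw
        simp only [dividedWronskian, if_neg (hne hw)]
      refine DifferentiableAt.congr_of_eventuallyEq ?_ this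
      exact (((hcomp hf ha hz).mul (hcomp hg hb hz)).sub
        ((hcomp hg ha hz).mul (hcomp hf hb hz))).div ((hdiv hz).sub (hdiv hz))
        (sub_ne_zero.2 (hne hz).symm)
  intro z hz
  refine DifferentiableAt.differentiableWithinAt ?_
  unfold rescaledKernel reExtension
  refine DifferentiableAt.mul ?_ (((key hz).add ?_).div_const _)
  · exact differentiableAt_id.cpow (differentiableAt_const _) (Or.inl hz.1)
  · have := (key (conj_mem_inverseStrip hz)).star_conj
    rw [Complex.conj_conj] at this
    exact this

theorem rescaledKernel_bounded (α : ℝ) {c : ℕ → ℂ} {c₀ : ℂ} (hc : Tendsto c atTop (𝓝 c₀))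
    {F G : ℕ → ℂ → ℂ} (hFb : StripBounded (3 / 4) F)
    (hGb : StripBounded (3 / 4) G) (hF : ∀ᶠ n in atTop, DifferentiableOn ℂ (F n) unitStrip)
    (hG : ∀ᶠ n in atTop, DifferentiableOn ℂ (G n) unitStrip) {z : ℂ} (hz : z ∈ inverseStrip) :
    ∃ M, ∃ r > 0, ∀ᶠ n in atTop, ∀ z' ∈ Metric.ball z r, ∀ a ∈ Ioo (0 : ℝ) 1,
      ∀ b ∈ Ioo (0 : ℝ) 1, ‖rescaledKernel α (c n) (F n) (G n) z' a b‖ ≤ M := by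
  have hz0 := ne_zero_of_mem_inverseStrip hz
  obtain ⟨M, hM⟩ := stripBounded_dividedWronskian hFb hGb hF hG (‖z⁻¹‖ + 1)
  have hpow : ContinuousAt (fun w : ℂ => ‖w ^ (-(2 * α + 1) : ℂ)‖) z :=
    (continuousAt_id.cpow continuousAt_const (Or.inl hz.1)).norm
  have hinv : ContinuousAt (fun w : ℂ => ‖w⁻¹‖) z := (continuousAt_inv₀ hz0).norm
  have hin : ∀ᶠ w in 𝓝 z, w ∈ inverseStrip := isOpen_inverseStrip.mem_nhds hz
  have hev := hin.and
    ((hpow.eventually_lt_const (lt_add_one _)).and (hinv.eventually_lt_const (lt_add_one _)))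
  obtain ⟨r, hr, hball⟩ := Metric.eventually_nhds_iff_ball.1 hev
  refine ⟨(‖z ^ (-(2 * α + 1) : ℂ)‖ + 1) * ((‖c₀‖ + 1) * M), r, hr, ?_⟩
  filter_upwards [hM, hc.norm.eventually_lt_const (lt_add_one _)] with n hn hcn w hw a ha b hb
  obtain ⟨hwU, hw1, hw2⟩ := hball w hw
  have hW {w : ℂ} (hwU : w ∈ inverseStrip) (hw2 : ‖w⁻¹‖ < ‖z⁻¹‖ + 1) :
      ‖c n * dividedWronskian (F n) (G n) (a / w) (b / w)‖ ≤ (‖c₀‖ + 1) * M := by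
    rw [norm_mul]
    gcongr
    exact hn _ _ ((norm_ofReal_div_le w ha).trans hw2.le) (abs_im_ofReal_div_le hwU.2 ha)
      ((norm_ofReal_div_le w hb).trans hw2.le) (abs_im_ofReal_div_le hwU.2 hb)
  have h1 := hW hwU hw2
  have h2 := hW (conj_mem_inverseStrip hwU) (by rwa [← map_inv₀, RCLike.norm_conj])
  rw [rescaledKernel, norm_mul]
  gcongr
  rw [reExtension, norm_div, Complex.norm_ofNat, div_le_iff₀ two_pos]
  refine (norm_add_le _ _).trans ?_
  rw [RCLike.norm_conj]
  linarith

theorem tendsto_rescaledKernel (α : ℝ) {c : ℕ → ℂ} {c₀ : ℂ} (hc : Tendsto c atTop (𝓝 c₀))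
    {F G : ℕ → ℂ → ℂ} {f g : ℂ → ℂ} (hFb : StripBounded (3 / 4) F)
    (hGb : StripBounded (3 / 4) G) (hF : ∀ᶠ n in atTop, DifferentiableOn ℂ (F n) unitStrip)
    (hG : ∀ᶠ n in atTop, DifferentiableOn ℂ (G n) unitStrip)
    (hf : DifferentiableOn ℂ f unitStrip) (hg : DifferentiableOn ℂ g unitStrip)
    (hFl : ∀ z ∈ unitStrip, Tendsto (fun n => F n z) atTop (𝓝 (f z)))
    (hGl : ∀ z ∈ unitStrip, Tendsto (fun n => G n z) atTop (𝓝 (g z)))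
    {z : ℂ} (hz : z ∈ inverseStrip) {a b : ℝ} (ha : a ∈ Ioo (0 : ℝ) 1) (hb : b ∈ Ioo (0 : ℝ) 1) :
    Tendsto (fun n => rescaledKernel α (c n) (F n) (G n) z a b) atTop
      (𝓝 (rescaledKernel α c₀ f g z a b)) := by
  have key {z : ℂ} (hz : z ∈ inverseStrip) :=
    hc.mul (tendsto_dividedWronskian hFb hGb hF hG hf hg hFl hGl
      (abs_im_ofReal_div_le hz.2 ha) (abs_im_ofReal_div_le hz.2 hb))
  exact (((key hz).add ((Complex.continuous_conj.tendsto _).comp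
    (key (conj_mem_inverseStrip hz)))).div_const _).const_mul _

/-- The weight `w ^ (2α)` on `(0, 1)`. -/
def powerWeight (α w : ℝ) : ℝ := w ^ (2 * α)

theorem integrableOn_powerWeight {α : ℝ} (hα : -(1 / 2) < α) :
    IntegrableOn (powerWeight α) (Ioo 0 1) :=
  (intervalIntegral.integrableOn_Ioo_rpow_iff one_pos).2 (by linarith)

theorem differentiableOn_fredholmSeries_rescaledKernel {α : ℝ} (hα : -(1 / 2) < α) (c : ℂ)
    {f g : ℂ → ℂ} (hf : DifferentiableOn ℂ f unitStrip) (hg : DifferentiableOn ℂ g unitStrip)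
    (hfm : Measurable f) (hgm : Measurable g) :
    DifferentiableOn ℂ
      (fun z => fredholmSeries (Ioo 0 1) (powerWeight α) (rescaledKernel α c f g z))
      inverseStrip := by
  refine differentiableOn_fredholmSeries measurableSet_Ioo
    (fun u hu => Real.rpow_nonneg hu.1.le _) (integrableOn_powerWeight hα) isOpen_inverseStrip
    (fun z _ => measurable_rescaledKernel α c hfm hgm z)
    (fun a ha b hb => differentiableOn_rescaledKernel α c hf hg ha hb) fun z hz => ?_
  obtain ⟨M, r, hr, h⟩ := rescaledKernel_bounded α (tendsto_const_nhds (x := c))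
    (stripBounded_const hf) (stripBounded_const hg) (Eventually.of_forall fun _ => hf)
    (Eventually.of_forall fun _ => hg) hz
  obtain ⟨n, hn⟩ := h.exists
  exact ⟨M, by filter_upwards [Metric.ball_mem_nhds z hr] with w hw using hn w hw⟩

theorem tendsto_iteratedDeriv_fredholmSeries_rescaledKernel {α : ℝ} (hα : -(1 / 2) < α)
    {c : ℕ → ℂ} {c₀ : ℂ} (hc : Tendsto c atTop (𝓝 c₀))
    {F G : ℕ → ℂ → ℂ} {f g : ℂ → ℂ} (hFb : StripBounded (3 / 4) F)
    (hGb : StripBounded (3 / 4) G) (hF : ∀ᶠ n in atTop, DifferentiableOn ℂ (F n) unitStrip)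
    (hG : ∀ᶠ n in atTop, DifferentiableOn ℂ (G n) unitStrip)
    (hFm : ∀ n, Measurable (F n)) (hGm : ∀ n, Measurable (G n))
    (hf : DifferentiableOn ℂ f unitStrip) (hg : DifferentiableOn ℂ g unitStrip)
    (hfm : Measurable f) (hgm : Measurable g)
    (hFl : ∀ z ∈ unitStrip, Tendsto (fun n => F n z) atTop (𝓝 (f z)))
    (hGl : ∀ z ∈ unitStrip, Tendsto (fun n => G n z) atTop (𝓝 (g z)))
    (p : ℕ) {z : ℂ} (hz : z ∈ inverseStrip) :
    Tendsto (fun n => iteratedDeriv p (fun z =>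
        fredholmSeries (Ioo 0 1) (powerWeight α) (rescaledKernel α (c n) (F n) (G n) z)) z) atTop
      (𝓝 (iteratedDeriv p (fun z =>
        fredholmSeries (Ioo 0 1) (powerWeight α) (rescaledKernel α c₀ f g z)) z)) := by
  refine tendsto_iteratedDeriv_fredholmSeries (k := fun n => rescaledKernel α (c n) (F n) (G n))
    (k₀ := rescaledKernel α c₀ f g) measurableSet_Ioo
    (fun u hu => Real.rpow_nonneg hu.1.le _) (integrableOn_powerWeight hα) isOpen_inverseStrip
    (Eventually.of_forall fun n z _ => measurable_rescaledKernel α (c n) (hFm n) (hGm n) z) ?_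
    (differentiableOn_fredholmSeries_rescaledKernel hα c₀ hf hg hfm hgm)
    (fun z hz => rescaledKernel_bounded α hc hFb hGb hF hG hz)
    (fun z hz a ha b hb => tendsto_rescaledKernel α hc hFb hGb hF hG hf hg hFl hGl hz ha hb) p hz
  filter_upwards [hF, hG] with n hn hn'
  exact differentiableOn_fredholmSeries_rescaledKernel hα (c n) hn hn' (hFm n) (hGm n)

/-- The Christoffel–Darboux type kernel built from two functions, with its Wronskian diagonal. -/
def wronskianKernel (c : ℂ) (Φ Ψ : ℝ → ℂ) (x y : ℝ) : ℂ :=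
  if x = y then c * (deriv Φ x * Ψ x - deriv Ψ x * Φ x)
  else c * (Φ x * Ψ y - Ψ x * Φ y) / ((x : ℂ) - (y : ℂ))

theorem hasDerivAt_of_eq_rpow_mul_comp_inv {α : ℝ} {A : ℂ} {Φ : ℝ → ℂ} {f : ℂ → ℂ}
    (hΦ : ∀ x : ℝ, 0 < x → Φ x = A * ((x ^ (-α) : ℝ) : ℂ) * f ((x⁻¹ : ℝ) : ℂ))
    {u : ℝ} (hu : 0 < u) (hf : DifferentiableAt ℂ f u) :
    HasDerivAt Φ (-(A * ((u ^ (α + 1) : ℝ) : ℂ) * (α * f u + u * deriv f u))) u⁻¹ := by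
  have hu' : 0 < u⁻¹ := inv_pos.2 hu
  have hf' : HasDerivAt f (deriv f u) (((u⁻¹)⁻¹ : ℝ) : ℂ) := by
    rw [inv_inv]
    exact hf.hasDerivAt
  have h1 : HasDerivAt (fun x : ℝ => ((x⁻¹ : ℝ) : ℂ)) ((-((u⁻¹) ^ 2)⁻¹ : ℝ) : ℂ) u⁻¹ :=
    (hasDerivAt_inv hu'.ne').ofReal_comp
  have h2 : HasDerivAt (fun x : ℝ => f ((x⁻¹ : ℝ) : ℂ)) _ u⁻¹ :=
    HasDerivAt.comp (h₂ := f) u⁻¹ hf' h1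
  have h3 : HasDerivAt (fun x : ℝ => ((x ^ (-α) : ℝ) : ℂ)) _ u⁻¹ :=
    (Real.hasDerivAt_rpow_const (p := -α) (Or.inl hu'.ne')).ofReal_comp
  have h4 := (h3.const_mul A).mul h2
  refine (h4.congr_of_eventuallyEq ?_).congr_deriv ?_
  · filter_upwards [lt_mem_nhds hu'] with x hx using hΦ x hx
  · have e1 : (u⁻¹) ^ (-α) = u ^ α := by
      rw [Real.inv_rpow hu.le, Real.rpow_neg hu.le, inv_inv]
    have e2 : (u⁻¹) ^ (-α - 1) = u ^ α * u := by
      rw [Real.inv_rpow hu.le, ← Real.rpow_neg hu.le, neg_sub, sub_neg_eq_add, add_comm,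
        Real.rpow_add_one hu.ne']
    rw [e1, e2, inv_inv, Real.rpow_add_one hu.ne']
    push_cast
    rw [inv_pow, inv_inv]
    ring

theorem wronskianKernel_inv {α : ℝ} {A B : ℂ} (c : ℂ) {Φ Ψ : ℝ → ℂ} {f g : ℂ → ℂ}
    (hΦ : ∀ x : ℝ, 0 < x → Φ x = A * ((x ^ (-α) : ℝ) : ℂ) * f ((x⁻¹ : ℝ) : ℂ))
    (hΨ : ∀ x : ℝ, 0 < x → Ψ x = B * ((x ^ (-α) : ℝ) : ℂ) * g ((x⁻¹ : ℝ) : ℂ))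
    (hf : ∀ u : ℝ, DifferentiableAt ℂ f u) (hg : ∀ u : ℝ, DifferentiableAt ℂ g u)
    {u v : ℝ} (hu : 0 < u) (hv : 0 < v) :
    wronskianKernel c Φ Ψ u⁻¹ v⁻¹ =
      (((u * v) ^ (α + 1) : ℝ) : ℂ) * (c * (A * B) * dividedWronskian f g u v) := by
  have e (w : ℝ) (hw : 0 < w) : (w⁻¹) ^ (-α) = w ^ α := by
    rw [Real.inv_rpow hw.le, Real.rpow_neg hw.le, inv_inv]
  rw [Real.mul_rpow hu.le hv.le, Real.rpow_add_one hu.ne', Real.rpow_add_one hv.ne']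
  by_cases huv : u = v
  · subst huv
    simp only [wronskianKernel, dividedWronskian, if_true]
    rw [(hasDerivAt_of_eq_rpow_mul_comp_inv hΦ hu (hf u)).deriv,
      (hasDerivAt_of_eq_rpow_mul_comp_inv hΨ hu (hg u)).deriv,
      hΦ _ (inv_pos.2 hu), hΨ _ (inv_pos.2 hu), e u hu, inv_inv, Real.rpow_add_one hu.ne']
    push_cast
    ring
  · have h1 : (u : ℂ) ≠ v := by exact_mod_cast huv
    have h2 : (u⁻¹ : ℝ) ≠ v⁻¹ := fun h => huv (inv_injective h)
    have hu0 : (u : ℂ) ≠ 0 := by exact_mod_cast hu.ne'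
    have hv0 : (v : ℂ) ≠ 0 := by exact_mod_cast hv.ne'
    have h3 : (v : ℂ) - u ≠ 0 := sub_ne_zero.2 h1.symm
    rw [wronskianKernel, if_neg h2, dividedWronskian, if_neg h1, hΦ _ (inv_pos.2 hu),
      hΨ _ (inv_pos.2 hu), hΦ _ (inv_pos.2 hv), hΨ _ (inv_pos.2 hv), e u hu, e v hv, inv_inv,
      inv_inv]
    have h4 : ((u⁻¹ : ℝ) : ℂ) - ((v⁻¹ : ℝ) : ℂ) = (v - u) / (u * v) := by
      push_cast
      field_simp
    rw [h4]
    push_cast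
    field_simp

theorem hasFDerivAt_pi_div {ι : Type*} [Fintype ι] (t : ℝ) {w : ι → ℝ} (hw : ∀ i, w i ≠ 0) :
    HasFDerivAt (fun (w : ι → ℝ) i => t / w i)
      (ContinuousLinearMap.pi fun i =>
        (ContinuousLinearMap.toSpanSingleton ℝ (-(t / w i ^ 2))).comp
          (ContinuousLinearMap.proj (R := ℝ) (φ := fun _ : ι => ℝ) i)) w := by
  refine hasFDerivAt_pi.2 fun i => ?_
  have h1 : HasDerivAt (fun x : ℝ => t / x) (-(t / w i ^ 2)) (w i) := by
    have := (hasDerivAt_inv (hw i)).const_mul t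
    simpa [div_eq_mul_inv] using this
  exact h1.hasFDerivAt.comp w (hasFDerivAt_apply i w)

theorem image_pi_div_Ioo {ι : Type*} {t : ℝ} (ht : 0 < t) :
    (fun (w : ι → ℝ) i => t / w i) '' (Set.univ.pi fun _ => Ioo 0 1) =
      Set.univ.pi fun _ => Ioi t := by
  ext x
  constructor
  · rintro ⟨w, hw, rfl⟩ i -
    obtain ⟨h1, h2⟩ := hw i (mem_univ i)
    exact (lt_div_iff₀ h1).2 (by nlinarith)
  · intro hx
    have hx' : ∀ i, t < x i := fun i => hx i (mem_univ i)
    refine ⟨fun i => t / x i, fun i _ => ⟨div_pos ht (ht.trans (hx' i)),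
      (div_lt_one (ht.trans (hx' i))).2 (hx' i)⟩, ?_⟩
    ext i
    have := (ht.trans (hx' i)).ne'
    have := ht.ne'
    field_simp

theorem setIntegral_pi_Ioi_eq {ι : Type*} [Fintype ι] {t : ℝ} (ht : 0 < t)
    (h : (ι → ℝ) → ℝ) :
    ∫ x in Set.univ.pi fun _ => Ioi t, h x =
      ∫ w in Set.univ.pi fun _ => Ioo 0 1, (∏ i, t / w i ^ 2) * h fun i => t / w i := by
  classical
  have hS : MeasurableSet (Set.univ.pi fun _ : ι => Ioo (0 : ℝ) 1) :=
    MeasurableSet.univ_pi fun _ => measurableSet_Ioo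
  rw [← image_pi_div_Ioo ht, integral_image_eq_integral_abs_det_fderiv_smul volume hS
    (fun w hw => (hasFDerivAt_pi_div t fun i => (hw i (mem_univ i)).1.ne').hasFDerivWithinAt)
    ?_ h]
  · refine setIntegral_congr_fun hS fun w _ => ?_
    simp only [smul_eq_mul]
    rw [ContinuousLinearMap.det_pi, Finset.abs_prod]
    congr 1
    refine Finset.prod_congr rfl fun i _ => ?_
    simp
    positivity
  · intro w _ w' _ hww
    ext i
    have := congrFun hww i
    simp only [div_eq_mul_inv] at this
    exact inv_injective (mul_left_cancel₀ ht.ne' this)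

theorem prod_jacobian_mul_det {ι : Type*} [Fintype ι] [DecidableEq ι] {α t : ℝ} (ht : 0 < t)
    (κ : ℝ → ℝ → ℝ) {w : ι → ℝ} (hw : ∀ i, 0 < w i) :
    (∏ i, t / w i ^ 2) * (Matrix.of fun i j =>
        ((w i / t) * (w j / t)) ^ (α + 1) * κ (w i / t) (w j / t)).det =
      (∏ i, w i ^ (2 * α)) * (Matrix.of fun i j =>
        t ^ (-(2 * α + 1)) * κ (w i / t) (w j / t)).det := by
  set B : Matrix ι ι ℝ := Matrix.of fun i j => κ (w i / t) (w j / t) with hB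
  have h1 : (Matrix.of fun i j => ((w i / t) * (w j / t)) ^ (α + 1) * κ (w i / t) (w j / t)) =
      Matrix.of fun i j => (w i / t) ^ (α + 1) *
        (Matrix.of fun i j => (w j / t) ^ (α + 1) * B i j) i j := by
    ext i j
    simp only [Matrix.of_apply, hB]
    rw [Real.mul_rpow (div_pos (hw i) ht).le (div_pos (hw j) ht).le, mul_assoc]
  have h2 : (Matrix.of fun i j => t ^ (-(2 * α + 1)) * κ (w i / t) (w j / t)) =
      Matrix.of fun i j => (fun _ : ι => t ^ (-(2 * α + 1))) i * B i j := rfl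
  rw [h1, h2, Matrix.det_mul_column, Matrix.det_mul_row, Matrix.det_mul_column, ← mul_assoc,
    ← mul_assoc, ← mul_assoc, ← Finset.prod_mul_distrib, ← Finset.prod_mul_distrib,
    ← Finset.prod_mul_distrib]
  congr 1
  refine Finset.prod_congr rfl fun i _ => ?_
  rw [Real.div_rpow (hw i).le ht.le, Real.rpow_neg ht.le, two_mul, Real.rpow_add_one (hw i).ne',
    Real.rpow_add_one ht.ne', Real.rpow_add_one ht.ne', Real.rpow_add ht, Real.rpow_add (hw i)]
  have := (hw i).ne'
  have := (Real.rpow_pos_of_pos ht α).ne'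
  field_simp

theorem rescaledKernel_ofReal {α : ℝ} (c : ℂ) (f g : ℂ → ℂ) {t : ℝ} (ht : 0 < t) (a b : ℝ) :
    rescaledKernel α c f g t a b = ((t ^ (-(2 * α + 1)) *
      (c * dividedWronskian f g ((a / t : ℝ) : ℂ) ((b / t : ℝ) : ℂ)).re : ℝ) : ℂ) := by
  rw [rescaledKernel, reExtension_ofReal]
  push_cast
  congr 1
  rw [Complex.ofReal_cpow ht.le]
  push_cast
  rfl

theorem fredholmDet_eq_re_fredholmSeries {α : ℝ} {c : ℂ} {f g : ℂ → ℂ} {K : ℝ → ℝ → ℝ}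
    (hK : ∀ u v : ℝ, 0 < u → 0 < v →
      K u⁻¹ v⁻¹ = (u * v) ^ (α + 1) * (c * dividedWronskian f g u v).re) {t : ℝ} (ht : 0 < t) :
    fredholmDet K t =
      (fredholmSeries (Ioo 0 1) (powerWeight α) (rescaledKernel α c f g t)).re := by
  have hterm (m : ℕ) : fredholmTerm (Ioo 0 1) (powerWeight α) (rescaledKernel α c f g t) m =
      (((-1 : ℝ) ^ m / m.factorial) *
        ∫ x : Fin m → ℝ in Set.univ.pi fun _ => Set.Ioi t, rhoK K m x : ℝ) := by
    rw [setIntegral_pi_Ioi_eq ht, fredholmTerm]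
    push_cast
    congr 1
    rw [← integral_complex_ofReal]
    refine setIntegral_congr_fun (MeasurableSet.univ_pi fun _ => measurableSet_Ioo) fun w hw => ?_
    have hw' : ∀ i, 0 < w i := fun i => (hw i (mem_univ i)).1
    have h1 : rhoK K m (fun i => t / w i) = (Matrix.of fun i j =>
        ((w i / t) * (w j / t)) ^ (α + 1) *
          (fun u v : ℝ => (c * dividedWronskian f g u v).re) (w i / t) (w j / t)).det := by
      rw [rhoK]
      congr 1
      ext i j
      simp only [Matrix.of_apply]
      rw [← hK _ _ (div_pos (hw' i) ht) (div_pos (hw' j) ht), inv_div, inv_div]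
    rw [h1, prod_jacobian_mul_det ht (fun u v : ℝ => (c * dividedWronskian f g u v).re) hw',
      Complex.ofReal_mul, Complex.ofReal_prod]
    congr 1
    refine Eq.trans ?_ (RingHom.map_det Complex.ofRealHom _).symm
    congr 1
    ext i j
    simp only [Matrix.of_apply, RingHom.mapMatrix_apply, Matrix.map_apply]
    exact rescaledKernel_ofReal c f g ht _ _
  rw [fredholmSeries, fredholmDet]
  simp_rw [hterm]
  rw [← Complex.ofReal_tsum, Complex.add_re, Complex.ofReal_re, Complex.one_re]

theorem norm_poch_neg_le (m k : ℕ) : ‖poch (-(m : ℂ)) k‖ ≤ (m : ℝ) ^ k := by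
  by_cases h : k ≤ m
  · rw [poch, norm_prod]
    calc ∏ i ∈ Finset.range k, ‖-(m : ℂ) + i‖ ≤ ∏ _i ∈ Finset.range k, (m : ℝ) := by
          refine Finset.prod_le_prod (fun _ _ => norm_nonneg _) fun i hi => ?_
          have hi' : i ≤ m := (Finset.mem_range.1 hi).le.trans h
          have : -(m : ℂ) + i = -((m - i : ℕ) : ℂ) := by
            push_cast [hi']
            ring
          rw [this, norm_neg, Complex.norm_natCast]
          exact_mod_cast Nat.sub_le m i
      _ = _ := by simp
  · have : poch (-(m : ℂ)) k = 0 :=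
      Finset.prod_eq_zero (Finset.mem_range.2 (not_le.1 h)) (by simp)
    rw [this, norm_zero]
    positivity

theorem norm_poch_div_poch_le (r : ℂ) {q : ℝ} (hq : 0 < q) (k : ℕ) :
    ‖poch r k / poch q k‖ ≤ (1 + ‖r‖ / q) ^ k := by
  rw [poch, poch, ← Finset.prod_div_distrib, norm_prod]
  calc ∏ i ∈ Finset.range k, ‖(r + i) / ((q : ℂ) + i)‖
      ≤ ∏ _i ∈ Finset.range k, (1 + ‖r‖ / q) := by
        refine Finset.prod_le_prod (fun _ _ => norm_nonneg _) fun i _ => ?_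
        have h1 : ‖(q : ℂ) + i‖ = q + i := by
          rw [← Complex.ofReal_natCast, ← Complex.ofReal_add, Complex.norm_real,
            Real.norm_of_nonneg (by positivity)]
        have h2 : ‖r + i‖ ≤ ‖r‖ + i := (norm_add_le _ _).trans (by simp)
        rw [norm_div, h1, div_le_iff₀ (by positivity)]
        refine h2.trans ?_
        have : (1 + ‖r‖ / q) * (q + i) = ‖r‖ + i + (q + ‖r‖ / q * i) := by
          field_simp
          ring
        rw [this]
        have : 0 ≤ q + ‖r‖ / q * i := by positivity
        linarith
    _ = _ := by simp

/-- The general term of a terminating Gauss hypergeometric series. -/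
def twoF1Term (m : ℕ) (r q z : ℂ) (k : ℕ) : ℂ :=
  poch (-(m : ℂ)) k * poch r k / (poch q k * (k.factorial : ℂ)) * z ^ k

theorem twoF1neg_eq_tsum (m : ℕ) (r q z : ℂ) : twoF1neg m r q z = ∑' k, twoF1Term m r q z k := by
  refine (tsum_eq_sum fun k hk => ?_).symm
  have : poch (-(m : ℂ)) k = 0 :=
    Finset.prod_eq_zero (Finset.mem_range.2 (by simpa [Nat.lt_succ_iff] using hk)) (by simp)
  simp [this]

theorem norm_natCast_mul_I_add_ge {N : ℕ} {R : ℝ} (hN : 2 * R ≤ N) {z : ℂ} (hz : ‖z‖ ≤ R) :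
    (N : ℝ) / 2 ≤ ‖z + N * I‖ := by
  have h1 : ‖(N : ℂ) * I‖ = N := by simp
  have h2 := norm_sub_le (z + N * I) z
  rw [add_sub_cancel_left, h1] at h2
  linarith

theorem norm_twoF1Term_le {m N : ℕ} (hm : m ≤ N) (hN1 : 1 ≤ N) {R : ℝ} (hN : 2 * R ≤ N)
    (r : ℂ) {q : ℝ} (hq : 0 < q) {z : ℂ} (hz : ‖z‖ ≤ R) (k : ℕ) :
    ‖twoF1Term m r q (2 * z / (z + N * I)) k‖ ≤
      (4 * R * (1 + ‖r‖ / q)) ^ k / k.factorial := by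
  have hN0 : (0 : ℝ) < N := by exact_mod_cast hN1
  have hR : 0 ≤ R := (norm_nonneg z).trans hz
  have h1 : ‖2 * z / (z + N * I)‖ ≤ 4 * R / N := by
    rw [norm_div, norm_mul, Complex.norm_ofNat]
    calc 2 * ‖z‖ / ‖z + N * I‖ ≤ 2 * R / (N / 2) := by
          gcongr
          exact norm_natCast_mul_I_add_ge hN hz
      _ = _ := by
        field_simp
        ring
  have h2 : ‖poch (-(m : ℂ)) k‖ ≤ (N : ℝ) ^ k :=
    (norm_poch_neg_le m k).trans (by gcongr)
  have h3 : twoF1Term m r q (2 * z / (z + N * I)) k =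
      poch (-(m : ℂ)) k * (poch r k / poch q k) * (2 * z / (z + N * I)) ^ k / k.factorial := by
    rw [twoF1Term]
    simp only [div_eq_mul_inv, mul_inv]
    ring
  rw [h3, norm_div, norm_mul, norm_mul, norm_pow, Complex.norm_natCast]
  gcongr
  calc ‖poch (-(m : ℂ)) k‖ * ‖poch r k / poch q k‖ * ‖2 * z / (z + N * I)‖ ^ k
      ≤ (N : ℝ) ^ k * (1 + ‖r‖ / q) ^ k * (4 * R / N) ^ k := by
        gcongr
        exact norm_poch_div_poch_le r hq k
    _ = _ := by
      rw [← mul_pow, ← mul_pow]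
      congr 1
      field_simp

theorem norm_twoF1neg_le {m N : ℕ} (hm : m ≤ N) (hN1 : 1 ≤ N) {R : ℝ} (hN : 2 * R ≤ N)
    (r : ℂ) {q : ℝ} (hq : 0 < q) {z : ℂ} (hz : ‖z‖ ≤ R) :
    ‖twoF1neg m r q (2 * z / (z + N * I))‖ ≤ Real.exp (4 * R * (1 + ‖r‖ / q)) := by
  rw [twoF1neg_eq_tsum, Real.exp_eq_exp_ℝ]
  exact tsum_of_norm_bounded (NormedSpace.expSeries_div_hasSum_exp _)
    (norm_twoF1Term_le hm hN1 hN r hq hz)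

theorem tendsto_twoF1neg {m : ℕ → ℕ} (hm : ∀ n, m n ≤ n)
    (hm' : Tendsto (fun n => (m n : ℂ) / n) atTop (𝓝 1)) (r : ℂ) {q : ℝ} (hq : 0 < q) (z : ℂ) :
    Tendsto (fun n : ℕ => twoF1neg (m n) r q (2 * z / (z + n * I))) atTop
      (𝓝 (oneF1 r q (2 * I * z))) := by
  simp_rw [twoF1neg_eq_tsum, oneF1]
  refine tendsto_tsum_of_dominated_convergence
    (Real.summable_pow_div_factorial (4 * ‖z‖ * (1 + ‖r‖ / q))) (fun k => ?_) ?_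
  · have hinv : Tendsto (fun n : ℕ => ((n : ℂ))⁻¹) atTop (𝓝 0) :=
      tendsto_inv_atTop_nhds_zero_nat (𝕜 := ℂ)
    have hfac (i : ℕ) : Tendsto (fun n : ℕ => (-(m n : ℂ) + i) * (2 * z / (z + n * I))) atTop
        (𝓝 (2 * I * z)) := by
      have h1 : Tendsto (fun n : ℕ => (-((m n : ℂ) / n) + i * (n : ℂ)⁻¹) *
          (2 * z / (z * (n : ℂ)⁻¹ + I))) atTop (𝓝 ((-1 + i * 0) * (2 * z / (z * 0 + I)))) :=
        (hm'.neg.add (hinv.const_mul _)).mul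
          (tendsto_const_nhds.div ((hinv.const_mul z).add_const I) (by simp))
      have h2 : (-1 + (i : ℂ) * 0) * (2 * z / (z * 0 + I)) = 2 * I * z := by
        simp only [mul_zero, add_zero, zero_add, Complex.div_I]
        ring
      rw [h2] at h1
      refine h1.congr' ?_
      filter_upwards [eventually_ge_atTop 1] with n hn
      have hn0 : (n : ℂ) ≠ 0 := by exact_mod_cast (by omega : n ≠ 0)
      have e1 : -((m n : ℂ) / n) + i * (n : ℂ)⁻¹ = (-(m n : ℂ) + i) / n := by
        field_simp
      have e2 : z * (n : ℂ)⁻¹ + I = (z + n * I) / n := by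
        field_simp
      rw [e1, e2, div_div_eq_mul_div, div_mul_div_comm, mul_div_assoc', mul_comm (n : ℂ),
        ← mul_assoc, mul_div_mul_right _ _ hn0]
    have hprod : Tendsto (fun n : ℕ => poch (-(m n : ℂ)) k * (2 * z / (z + n * I)) ^ k) atTop
        (𝓝 ((2 * I * z) ^ k)) := by
      have := tendsto_finsetProd (Finset.range k) fun i _ => hfac i
      rw [Finset.prod_const, Finset.card_range] at this
      simpa only [poch, Finset.prod_mul_distrib, Finset.prod_const, Finset.card_range] using this
    have := hprod.const_mul (poch r k / (poch q k * k.factorial))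
    refine this.congr fun n => ?_
    rw [twoF1Term]
    ring
  · filter_upwards [eventually_ge_atTop 1, eventually_ge_atTop ⌈2 * ‖z‖⌉₊] with n hn hn' k
    exact norm_twoF1Term_le (hm n) hn (Nat.ceil_le.1 hn') r hq le_rfl k

theorem differentiable_oneF1 (r : ℂ) {q : ℝ} (hq : 0 < q) : Differentiable ℂ (oneF1 r q) := by
  intro z
  have hball : DifferentiableOn ℂ (oneF1 r q) (Metric.ball 0 (‖z‖ + 1)) := by
    refine differentiableOn_tsum_of_summable_norm
      (Real.summable_pow_div_factorial ((1 + ‖r‖ / q) * (‖z‖ + 1)))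
      (fun n => ((differentiable_id.pow n).const_mul _).differentiableOn) Metric.isOpen_ball
      fun n w hw => ?_
    have hw' : ‖w‖ ≤ ‖z‖ + 1 := by simpa using (Metric.mem_ball.1 hw).le
    rw [← div_div, norm_mul, norm_div _ ((n.factorial : ℂ)), Complex.norm_natCast, norm_pow,
      mul_pow, div_mul_eq_mul_div]
    gcongr
    exact norm_poch_div_poch_le r hq n
  exact hball.differentiableAt (Metric.isOpen_ball.mem_nhds (by simp))

theorem differentiable_twoF1neg (m : ℕ) (r q : ℂ) : Differentiable ℂ (twoF1neg m r q) := by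
  unfold twoF1neg
  fun_prop

/-- The logarithm `log (1 + iz/N)`. -/
def scaledLog (N : ℕ) (z : ℂ) : ℂ := Complex.log (1 + z * I / N)

/-- The exponent of the holomorphic form of the square root of the weight `w_H`. -/
def weightExponent (s : ℂ) (N : ℕ) (z : ℂ) : ℂ :=
  -(s.re / 2) * (scaledLog N z + scaledLog N (-z)) + s.im * Real.pi / 2 +
    s.im / 2 * I * (scaledLog N z - scaledLog N (-z)) -
    N * (scaledLog N z - scaledLog N (-z)) / 2

/-- The holomorphic form of `x ↦ p̃_N √w_H` in the variable `N / x`. -/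
def holoPhi (s : ℂ) (N : ℕ) (z : ℂ) : ℂ :=
  Complex.exp (weightExponent s N z) *
    twoF1neg N s ((2 * s.re + 1 : ℝ) : ℂ) (2 * z / (z + N * I))

/-- The holomorphic form of `x ↦ p_{N-1} √w_H` in the variable `N / x`. -/
def holoPsi (s : ℂ) (N : ℕ) (z : ℂ) : ℂ :=
  Complex.exp (weightExponent s N z) * (z / (1 + -z * I / N)) *
    twoF1neg (N - 1) (s + 1) ((2 * s.re + 2 : ℝ) : ℂ) (2 * z / (z + N * I))

/-- The holomorphic form of `P̃` in the variable `1 / x`. -/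
def limitPhi (s : ℂ) (z : ℂ) : ℂ :=
  Complex.exp (s.im * Real.pi / 2 - z * I) * oneF1 s ((2 * s.re + 1 : ℝ) : ℂ) (2 * I * z)

/-- The holomorphic form of `Q` in the variable `1 / x`. -/
def limitPsi (s : ℂ) (z : ℂ) : ℂ :=
  Complex.exp (s.im * Real.pi / 2 - z * I) * z *
    oneF1 (s + 1) ((2 * s.re + 2 : ℝ) : ℂ) (2 * I * z)

theorem abs_im_div_natCast_lt {N : ℕ} (hN : 1 ≤ N) {z : ℂ} (hz : z ∈ unitStrip) :
    |(z / N).im| < 1 := by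
  have hN' : (1 : ℝ) ≤ N := by exact_mod_cast hN
  rw [Complex.div_natCast_im, abs_div, Nat.abs_cast, div_lt_one (by linarith)]
  exact lt_of_lt_of_le hz hN'

theorem one_add_mem_slitPlane {N : ℕ} (hN : 1 ≤ N) {z : ℂ} (hz : z ∈ unitStrip) :
    1 + z * I / N ∈ slitPlane := by
  refine Or.inl ?_
  have h := (abs_lt.1 (abs_im_div_natCast_lt hN hz)).2
  rw [mul_div_right_comm]
  simp only [Complex.add_re, Complex.one_re, Complex.mul_I_re]
  linarith

theorem neg_mem_unitStrip {z : ℂ} (hz : z ∈ unitStrip) : -z ∈ unitStrip := by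
  simpa [unitStrip] using hz

theorem add_natCast_mul_I_ne_zero {N : ℕ} (hN : 1 ≤ N) {z : ℂ} (hz : z ∈ unitStrip) :
    z + N * I ≠ 0 := by
  intro h
  have h1 := congrArg Complex.im h
  have h2 := (abs_lt.1 (show |z.im| < 1 from hz)).1
  have hN' : (1 : ℝ) ≤ N := by exact_mod_cast hN
  simp at h1
  linarith

theorem differentiableAt_scaledLog {N : ℕ} (hN : 1 ≤ N) {z : ℂ} (hz : z ∈ unitStrip) :
    DifferentiableAt ℂ (scaledLog N) z :=
  DifferentiableAt.clog (by fun_prop) (one_add_mem_slitPlane hN hz)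

theorem differentiableAt_exp_weightExponent (s : ℂ) {N : ℕ} (hN : 1 ≤ N) {z : ℂ}
    (hz : z ∈ unitStrip) : DifferentiableAt ℂ (fun z => Complex.exp (weightExponent s N z)) z := by
  have h1 := differentiableAt_scaledLog hN hz
  have h2 : DifferentiableAt ℂ (fun z => scaledLog N (-z)) z :=
    (differentiableAt_scaledLog hN (neg_mem_unitStrip hz)).comp z differentiableAt_id.neg
  unfold weightExponent
  fun_prop

theorem differentiableAt_twoF1neg_comp (m : ℕ) (r q : ℂ) {N : ℕ} (hN : 1 ≤ N) {z : ℂ}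
    (hz : z ∈ unitStrip) :
    DifferentiableAt ℂ (fun z => twoF1neg m r q (2 * z / (z + N * I))) z :=
  (differentiable_twoF1neg m r q _).comp z
    (DifferentiableAt.div (by fun_prop) (by fun_prop) (add_natCast_mul_I_ne_zero hN hz))

theorem differentiableOn_holoPhi (s : ℂ) {N : ℕ} (hN : 1 ≤ N) :
    DifferentiableOn ℂ (holoPhi s N) unitStrip := fun _ hz =>
  ((differentiableAt_exp_weightExponent s hN hz).mul
    (differentiableAt_twoF1neg_comp _ _ _ hN hz)).differentiableWithinAt

theorem differentiableOn_holoPsi (s : ℂ) {N : ℕ} (hN : 1 ≤ N) :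
    DifferentiableOn ℂ (holoPsi s N) unitStrip := fun _ hz =>
  (((differentiableAt_exp_weightExponent s hN hz).mul
    (differentiableAt_id.div (by fun_prop)
      (slitPlane_ne_zero (one_add_mem_slitPlane hN (neg_mem_unitStrip hz))))).mul
    (differentiableAt_twoF1neg_comp _ _ _ hN hz)).differentiableWithinAt

theorem differentiable_limitPhi {s : ℂ} (hs : -(1 / 2 : ℝ) < s.re) :
    Differentiable ℂ (limitPhi s) := by
  have h := differentiable_oneF1 s (show 0 < 2 * s.re + 1 by linarith)
  unfold limitPhi
  exact Differentiable.mul (by fun_prop) (h.comp (by fun_prop))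

theorem differentiable_limitPsi {s : ℂ} (hs : -(1 / 2 : ℝ) < s.re) :
    Differentiable ℂ (limitPsi s) := by
  have h := differentiable_oneF1 (s + 1) (show 0 < 2 * s.re + 2 by linarith)
  unfold limitPsi
  exact Differentiable.mul (by fun_prop) (h.comp (by fun_prop))

theorem measurable_exp_weightExponent (s : ℂ) (N : ℕ) :
    Measurable fun z => Complex.exp (weightExponent s N z) := by
  have h : Measurable (scaledLog N) := by
    unfold scaledLog
    fun_prop
  have h' : Measurable fun z => scaledLog N (-z) := h.comp measurable_neg
  unfold weightExponent
  fun_prop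

theorem measurable_twoF1neg_comp (m : ℕ) (r q : ℂ) (N : ℕ) :
    Measurable fun z => twoF1neg m r q (2 * z / (z + N * I)) :=
  (differentiable_twoF1neg m r q).continuous.measurable.comp (by fun_prop)

theorem measurable_holoPhi (s : ℂ) (N : ℕ) : Measurable (holoPhi s N) :=
  (measurable_exp_weightExponent s N).mul (measurable_twoF1neg_comp _ _ _ N)

theorem measurable_holoPsi (s : ℂ) (N : ℕ) : Measurable (holoPsi s N) :=
  ((measurable_exp_weightExponent s N).mul (by fun_prop)).mul (measurable_twoF1neg_comp _ _ _ N)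

theorem tendsto_natCast_mul_scaledLog (z : ℂ) :
    Tendsto (fun N : ℕ => N * scaledLog N z) atTop (𝓝 (z * I)) := by
  refine Complex.tendsto_nat_mul_log_one_add_of_tendsto ?_
  refine tendsto_const_nhds.congr' ?_
  filter_upwards [eventually_ge_atTop 1] with n hn
  have hn0 : (n : ℂ) ≠ 0 := by exact_mod_cast (by omega : n ≠ 0)
  field_simp

theorem tendsto_scaledLog (z : ℂ) : Tendsto (fun N : ℕ => scaledLog N z) atTop (𝓝 0) := by
  have h := (tendsto_natCast_mul_scaledLog z).mul (tendsto_inv_atTop_nhds_zero_nat (𝕜 := ℂ))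
  rw [mul_zero] at h
  refine h.congr' ?_
  filter_upwards [eventually_ge_atTop 1] with n hn
  have hn0 : (n : ℂ) ≠ 0 := by exact_mod_cast (by omega : n ≠ 0)
  field_simp

theorem tendsto_exp_weightExponent (s z : ℂ) :
    Tendsto (fun N => Complex.exp (weightExponent s N z)) atTop
      (𝓝 (Complex.exp (s.im * Real.pi / 2 - z * I))) := by
  refine (Complex.continuous_exp.tendsto _).comp ?_
  have h1 := tendsto_scaledLog z
  have h2 := tendsto_scaledLog (-z)
  have h3 := ((((h1.add h2).const_mul (-(s.re / 2) : ℂ)).add_const (s.im * Real.pi / 2 : ℂ)).add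
    ((h1.sub h2).const_mul (s.im / 2 * I))).sub (((tendsto_natCast_mul_scaledLog z).sub
      (tendsto_natCast_mul_scaledLog (-z))).div_const 2)
  have e : -(s.re / 2 : ℂ) * (0 + 0) + s.im * Real.pi / 2 + s.im / 2 * I * (0 - 0) -
      (z * I - -z * I) / 2 = s.im * Real.pi / 2 - z * I := by
    ring
  rw [e] at h3
  refine h3.congr fun N => ?_
  rw [weightExponent]
  ring

theorem tendsto_holoPhi {s : ℂ} (hs : -(1 / 2 : ℝ) < s.re) (z : ℂ) :
    Tendsto (fun N => holoPhi s N z) atTop (𝓝 (limitPhi s z)) := by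
  refine (tendsto_exp_weightExponent s z).mul
    (tendsto_twoF1neg (fun _ => le_rfl) ?_ s (by linarith) z)
  refine tendsto_const_nhds.congr' ?_
  filter_upwards [eventually_ge_atTop 1] with n hn
  exact (div_self (by exact_mod_cast (by omega : n ≠ 0))).symm

theorem tendsto_holoPsi {s : ℂ} (hs : -(1 / 2 : ℝ) < s.re) (z : ℂ) :
    Tendsto (fun N => holoPsi s N z) atTop (𝓝 (limitPsi s z)) := by
  have hinv := tendsto_inv_atTop_nhds_zero_nat (𝕜 := ℂ)
  refine ((tendsto_exp_weightExponent s z).mul ?_).mul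
    (tendsto_twoF1neg (m := fun n => n - 1) (fun n => Nat.sub_le n 1) ?_ (s + 1)
      (by linarith) z)
  · have h : Tendsto (fun N : ℕ => z / (1 + -z * I * (N : ℂ)⁻¹)) atTop
        (𝓝 (z / (1 + -z * I * 0))) :=
      tendsto_const_nhds.div ((hinv.const_mul _).const_add 1) (by simp)
    simpa [div_eq_mul_inv] using h
  · have h : Tendsto (fun n : ℕ => 1 - (n : ℂ)⁻¹) atTop (𝓝 (1 - 0)) := hinv.const_sub 1
    rw [sub_zero] at h
    refine h.congr' ?_
    filter_upwards [eventually_ge_atTop 1] with n hn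
    have hn0 : (n : ℂ) ≠ 0 := by exact_mod_cast (by omega : n ≠ 0)
    push_cast [hn]
    field_simp

theorem norm_natCast_mul_scaledLog_le {N : ℕ} (hN1 : 1 ≤ N) {R : ℝ} (hN : 2 * R ≤ N) {z : ℂ}
    (hz : ‖z‖ ≤ R) : N * ‖scaledLog N z‖ ≤ 3 / 2 * R := by
  have hN0 : (0 : ℝ) < N := by exact_mod_cast hN1
  have h1 : ‖z * I / N‖ = ‖z‖ / N := by simp
  have h2 : ‖z * I / N‖ ≤ 1 / 2 := by
    rw [h1, div_le_iff₀ hN0]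
    linarith
  have h3 := Complex.norm_log_one_add_half_le_self h2
  rw [h1] at h3
  calc N * ‖scaledLog N z‖ ≤ N * (3 / 2 * (‖z‖ / N)) := by
        gcongr
        exact h3
    _ = 3 / 2 * ‖z‖ := by field_simp
    _ ≤ _ := by gcongr

/-- A bound for `weightExponent` on the disc of radius `R`, uniform in `N ≥ 2R`. -/
def weightExponentBound (s : ℂ) (R : ℝ) : ℝ :=
  ‖(s.re / 2 : ℂ)‖ * (3 * R) + ‖(s.im * Real.pi / 2 : ℂ)‖ + ‖(s.im / 2 * I : ℂ)‖ * (3 * R) +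
    3 * R / 2

theorem norm_exp_weightExponent_le (s : ℂ) {N : ℕ} (hN1 : 1 ≤ N) {R : ℝ} (hN : 2 * R ≤ N) {z : ℂ}
    (hz : ‖z‖ ≤ R) :
    ‖Complex.exp (weightExponent s N z)‖ ≤ Real.exp (weightExponentBound s R) := by
  have hN' : (1 : ℝ) ≤ N := by exact_mod_cast hN1
  have a1 := norm_natCast_mul_scaledLog_le hN1 hN hz
  have a2 := norm_natCast_mul_scaledLog_le hN1 hN (z := -z) (by rwa [norm_neg])
  have b1 : ‖scaledLog N z‖ ≤ N * ‖scaledLog N z‖ :=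
    le_mul_of_one_le_left (norm_nonneg _) hN'
  have b2 : ‖scaledLog N (-z)‖ ≤ N * ‖scaledLog N (-z)‖ :=
    le_mul_of_one_le_left (norm_nonneg _) hN'
  have c1 : ‖scaledLog N z + scaledLog N (-z)‖ ≤ 3 * R := (norm_add_le _ _).trans (by linarith)
  have c2 : ‖scaledLog N z - scaledLog N (-z)‖ ≤ 3 * R := (norm_sub_le _ _).trans (by linarith)
  have c3 : ‖N * (scaledLog N z - scaledLog N (-z))‖ ≤ 3 * R := by
    rw [norm_mul, Complex.norm_natCast]
    have := mul_le_mul_of_nonneg_left (norm_sub_le (scaledLog N z) (scaledLog N (-z)))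
      (Nat.cast_nonneg (α := ℝ) N)
    linarith
  rw [Complex.norm_exp]
  refine Real.exp_le_exp.2 ((Complex.re_le_norm _).trans ?_)
  unfold weightExponent weightExponentBound
  refine (norm_sub_le _ _).trans (add_le_add ((norm_add_le _ _).trans (add_le_add
    ((norm_add_le _ _).trans (add_le_add ?_ le_rfl)) ?_)) ?_)
  · rw [norm_mul, norm_neg]
    gcongr
  · rw [norm_mul]
    gcongr
  · rw [norm_div, Complex.norm_ofNat]
    gcongr

theorem stripBounded_holoPhi {s : ℂ} (hs : -(1 / 2 : ℝ) < s.re) (δ : ℝ) :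
    StripBounded δ (holoPhi s) := by
  intro R
  refine ⟨Real.exp (weightExponentBound s R) *
    Real.exp (4 * R * (1 + ‖s‖ / (2 * s.re + 1))), ?_⟩
  filter_upwards [eventually_ge_atTop 1, eventually_ge_atTop ⌈2 * R⌉₊] with N hN hN' z hz _
  have hR := Nat.ceil_le.1 hN'
  rw [holoPhi, norm_mul]
  exact mul_le_mul (norm_exp_weightExponent_le s hN hR hz)
    (norm_twoF1neg_le le_rfl hN hR s (by linarith) hz) (norm_nonneg _) (Real.exp_pos _).le

theorem stripBounded_holoPsi {s : ℂ} (hs : -(1 / 2 : ℝ) < s.re) (δ : ℝ) :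
    StripBounded δ (holoPsi s) := by
  intro R
  refine ⟨Real.exp (weightExponentBound s R) * (R / (1 / 2)) *
    Real.exp (4 * R * (1 + ‖s + 1‖ / (2 * s.re + 2))), ?_⟩
  filter_upwards [eventually_ge_atTop 1, eventually_ge_atTop ⌈2 * R⌉₊] with N hN hN' z hz _
  have hR := Nat.ceil_le.1 hN'
  have hR0 : 0 ≤ R := (norm_nonneg z).trans hz
  have hN0 : (0 : ℝ) < N := by exact_mod_cast hN
  have h1 : 1 / 2 ≤ ‖1 + -z * I / N‖ := by
    have h2 : ‖-z * I / N‖ ≤ 1 / 2 := by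
      simp only [norm_div, norm_mul, norm_neg, Complex.norm_I, mul_one, Complex.norm_natCast]
      rw [div_le_iff₀ hN0]
      linarith
    have h3 := norm_sub_le (1 + -z * I / N) (-z * I / N)
    rw [add_sub_cancel_right, norm_one] at h3
    linarith
  have h2 : ‖z / (1 + -z * I / N)‖ ≤ R / (1 / 2) := by
    rw [norm_div]
    gcongr
  rw [holoPsi, norm_mul, norm_mul]
  exact mul_le_mul (mul_le_mul (norm_exp_weightExponent_le s hN hR hz) h2 (norm_nonneg _)
    (Real.exp_pos _).le) (norm_twoF1neg_le (Nat.sub_le N 1) hN hR (s + 1) (by linarith) hz)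
    (norm_nonneg _) (by positivity)

theorem Gamma_add_natCast_eq_prod {p : ℝ} (hp : 0 < p) (n : ℕ) :
    Real.Gamma (p + n) = (∏ j ∈ Finset.range n, (p + j)) * Real.Gamma p := by
  induction n with
  | zero => simp
  | succ n ih =>
    rw [Nat.cast_succ, ← add_assoc, Real.Gamma_add_one (by positivity), ih,
      Finset.prod_range_succ]
    ring

theorem tendsto_Gamma_add_natCast_div {p : ℝ} (hp : 0 < p) :
    Tendsto (fun n : ℕ => Real.Gamma (p + n) / (Real.Gamma n * (n : ℝ) ^ p)) atTop (𝓝 1) := by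
  have hΓ : Real.Gamma p ≠ 0 := (Real.Gamma_pos_of_pos hp).ne'
  have h1 := ((tendsto_const_nhds (x := Real.Gamma p)).div
    (Real.GammaSeq_tendsto_Gamma p) hΓ).mul (tendsto_natCast_div_add_atTop p)
  rw [div_self hΓ, mul_one] at h1
  refine h1.congr' ?_
  filter_upwards [eventually_ge_atTop 1] with n hn
  have hn0 : (0 : ℝ) < n := by exact_mod_cast hn
  have h2 : (n.factorial : ℝ) = n * Real.Gamma n := by
    rw [← Real.Gamma_nat_eq_factorial, Real.Gamma_add_one hn0.ne']
  have h3 : 0 < Real.Gamma n := Real.Gamma_pos_of_pos hn0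
  have h4 : 0 < (n : ℝ) ^ p := Real.rpow_pos_of_pos hn0 p
  have h5 : 0 < ∏ j ∈ Finset.range n, (p + (j : ℝ)) :=
    Finset.prod_pos fun j _ => by positivity
  simp only [Pi.div_apply]
  rw [Gamma_add_natCast_eq_prod hp, Real.GammaSeq, Finset.prod_range_succ, h2]
  field_simp
  ring

/-- The constant of the rescaled kernel in the variables `1 / x`, `1 / y`. -/
def scaledConst (s : ℂ) (N : ℕ) : ℂ :=
  CNs s N * ((((N : ℝ) ^ (-s.re) : ℝ) : ℂ) * ((((N : ℝ) ^ (-s.re) : ℝ) : ℂ) * (N : ℂ)⁻¹))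

/-- The constant of the limiting kernel in the variables `1 / x`, `1 / y`. -/
def limitConst (s : ℂ) : ℂ :=
  cinf s * ((((2 : ℝ) ^ s.re : ℝ) : ℂ) * (2 * (((2 : ℝ) ^ s.re : ℝ) : ℂ)))

theorem tendsto_scaledConst {s : ℂ} (hs : -(1 / 2 : ℝ) < s.re) :
    Tendsto (scaledConst s) atTop (𝓝 (limitConst s)) := by
  have h := ((Complex.continuous_ofReal.tendsto _).comp
    (tendsto_Gamma_add_natCast_div (show 0 < 2 * s.re + 1 by linarith))).const_mul (limitConst s)
  rw [Complex.ofReal_one, mul_one] at h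
  refine h.congr' ?_
  filter_upwards [eventually_ge_atTop 1] with N hN
  have hN0 : (0 : ℝ) < N := by exact_mod_cast hN
  have e1 : (N : ℝ) ^ (-s.re) * ((N : ℝ) ^ (-s.re) * (N : ℝ)⁻¹) =
      ((N : ℝ) ^ (2 * s.re + 1))⁻¹ := by
    rw [Real.rpow_add_one hN0.ne', two_mul, Real.rpow_add hN0, Real.rpow_neg hN0.le]
    simp only [mul_inv]
    ring
  have e2 : (2 : ℝ) ^ (2 * s.re) = (2 : ℝ) ^ s.re * (2 : ℝ) ^ s.re := by
    rw [two_mul, Real.rpow_add two_pos]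
  have e3 : (((N : ℝ) ^ (-s.re) : ℝ) : ℂ) * ((((N : ℝ) ^ (-s.re) : ℝ) : ℂ) * (N : ℂ)⁻¹) =
      ((((N : ℝ) ^ (2 * s.re + 1)) : ℝ) : ℂ)⁻¹ := by
    rw [← Complex.ofReal_inv, ← e1]
    push_cast
    rfl
  rw [scaledConst, limitConst, e3, CNs, cinf, e2, ← Complex.ofReal_natCast N, Complex.Gamma_ofReal,
    Complex.Gamma_ofReal, Complex.Gamma_ofReal, Complex.Gamma_ofReal, Function.comp_apply,
    show 2 * s.re + 1 + (N : ℝ) = 2 * s.re + N + 1 by ring]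
  simp only [div_eq_mul_inv, mul_inv, Complex.ofReal_mul, Complex.ofReal_inv, one_mul]
  ring

theorem arg_one_add_I_mul {y : ℝ} (hy : 0 < y) :
    Complex.arg (1 + I * y) = Real.pi / 2 + Complex.arg (1 - I / y) := by
  have hy0 : (y : ℂ) ≠ 0 := by exact_mod_cast hy.ne'
  have hre : (1 - I / (y : ℂ)).re = 1 := by simp [Complex.div_ofReal_re]
  have hne : 1 - I / (y : ℂ) ≠ 0 := by
    intro h
    rw [h] at hre
    simp at hre
  have harg : |Complex.arg (1 - I / (y : ℂ))| < Real.pi / 2 :=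
    Complex.abs_arg_lt_pi_div_two_iff.2 (Or.inl (by rw [hre]; exact one_pos))
  have h1 : 1 + I * (y : ℂ) = y * (I * (1 - I / y)) := by
    field_simp
    rw [mul_sub, Complex.I_mul_I]
    ring
  rw [h1, Complex.arg_real_mul _ hy, ← Complex.arg_I]
  refine (Complex.arg_mul_eq_add_arg_iff Complex.I_ne_zero hne).2 ?_
  rw [Complex.arg_I]
  have := abs_lt.1 harg
  constructor <;> linarith [Real.pi_pos]

theorem pow_mul_sqrt_wH (s : ℂ) {N : ℕ} (hN : 1 ≤ N) {y : ℝ} (hy : 0 < y) :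
    ((y : ℂ) - I) ^ N * (Real.sqrt (wH s N y) : ℂ) =
      ((y ^ (-s.re) : ℝ) : ℂ) * Complex.exp (weightExponent s N (N / y)) := by
  have hy0 : (y : ℂ) ≠ 0 := by exact_mod_cast hy.ne'
  have hN0 : (N : ℂ) ≠ 0 := by exact_mod_cast (by omega : N ≠ 0)
  set q : ℂ := 1 - I / y with hq
  have hre : q.re = 1 := by simp [hq, Complex.div_ofReal_re]
  have him : q.im = -y⁻¹ := by simp [hq, Complex.div_ofReal_im]
  have hq0 : q ≠ 0 := by
    intro h
    rw [h] at hre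
    simp at hre
  have hargπ : q.arg ≠ Real.pi := by
    have : |q.arg| < Real.pi / 2 :=
      Complex.abs_arg_lt_pi_div_two_iff.2 (Or.inl (by rw [hre]; exact one_pos))
    have := (abs_lt.1 this).2
    linarith [Real.pi_pos]
  have hlogq : Complex.log q = Real.log ‖q‖ + q.arg * I := rfl
  have hlogq' : Complex.log ((starRingEnd ℂ) q) = Real.log ‖q‖ - q.arg * I := by
    rw [Complex.log_conj _ hargπ, hlogq]
    simp [sub_eq_add_neg]
  have hL1 : scaledLog N (N / y) = Real.log ‖q‖ - q.arg * I := by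
    rw [← hlogq', scaledLog]
    congr 1
    apply Complex.ext
    · rw [Complex.conj_re, hre, show (N : ℂ) / y * I / N = I / y by field_simp]
      simp [Complex.div_ofReal_re]
    · rw [Complex.conj_im, him, show (N : ℂ) / y * I / N = I / y by field_simp]
      simp [Complex.div_ofReal_im]
  have hL2 : scaledLog N (-(N / y)) = Real.log ‖q‖ + q.arg * I := by
    rw [← hlogq, scaledLog, hq]
    congr 1
    field_simp
    ring
  have hyI : (y : ℂ) - I = Complex.exp (Real.log y + (Real.log ‖q‖ + q.arg * I)) := by
    rw [Complex.exp_add, ← hlogq, Complex.exp_log hq0, ← Complex.ofReal_exp, Real.exp_log hy, hq]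
    field_simp
  have hsq : 1 + y ^ 2 = Real.exp (2 * (Real.log y + Real.log ‖q‖)) := by
    have h1 : ‖q‖ ^ 2 = 1 + (y⁻¹) ^ 2 := by
      rw [← Complex.normSq_eq_norm_sq, Complex.normSq_apply, hre, him]
      ring
    rw [two_mul, Real.exp_add, Real.exp_add, Real.exp_log hy, Real.exp_log (norm_pos_iff.2 hq0),
      show y * ‖q‖ * (y * ‖q‖) = y ^ 2 * ‖q‖ ^ 2 by ring, h1]
    field_simp
    ring
  have hsqrt : Real.sqrt (wH s N y) = Real.exp ((-s.re - N) * (Real.log y + Real.log ‖q‖) +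
      s.im * (Real.pi / 2 + q.arg)) := by
    rw [wH, hsq, arg_one_add_I_mul hy, ← hq, ← Real.exp_mul, ← Real.exp_add, ← Real.exp_half]
    congr 1
    ring
  rw [hsqrt, hyI, ← Complex.exp_nat_mul, Real.rpow_def_of_pos hy, Complex.ofReal_exp,
    Complex.ofReal_exp, ← Complex.exp_add, ← Complex.exp_add, weightExponent, hL1, hL2]
  congr 1
  push_cast
  linear_combination (s.im * q.arg : ℂ) * Complex.I_sq

theorem ofReal_sub_I_ne_zero (y : ℝ) : (y : ℂ) - I ≠ 0 := by
  intro h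
  have := congrArg Complex.im h
  simp at this

theorem one_add_I_mul_ofReal_ne_zero (y : ℝ) : 1 + I * (y : ℂ) ≠ 0 := by
  intro h
  have := congrArg Complex.re h
  simp at this

theorem phiN_mul_eq (s : ℂ) {N : ℕ} (hN : 1 ≤ N) {x : ℝ} (hx : 0 < x) :
    phiN s N (N * x) = (((N : ℝ) ^ (-s.re) : ℝ) : ℂ) * ((x ^ (-s.re) : ℝ) : ℂ) *
      holoPhi s N ((x⁻¹ : ℝ) : ℂ) := by
  have hN0 : (0 : ℝ) < N := by exact_mod_cast hN
  have hx0 : (x : ℂ) ≠ 0 := by exact_mod_cast hx.ne'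
  have hNc : (N : ℂ) ≠ 0 := by exact_mod_cast hN0.ne'
  have h1 := pow_mul_sqrt_wH s hN (mul_pos hN0 hx)
  have h2 : (N : ℂ) / ((N * x : ℝ) : ℂ) = ((x⁻¹ : ℝ) : ℂ) := by
    push_cast
    field_simp
  have h3 : 2 / (1 + I * ((N * x : ℝ) : ℂ)) =
      2 * ((x⁻¹ : ℝ) : ℂ) / (((x⁻¹ : ℝ) : ℂ) + N * I) := by
    have e : ((x⁻¹ : ℝ) : ℂ) + N * I = (1 + I * ((N * x : ℝ) : ℂ)) / x := by
      push_cast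
      field_simp
    have h4 := one_add_I_mul_ofReal_ne_zero (N * x)
    rw [e]
    push_cast at h4 ⊢
    field_simp
  rw [h2, Real.mul_rpow hN0.le hx.le] at h1
  rw [phiN, pTil, holoPhi, h3, mul_right_comm, h1]
  push_cast
  ring

theorem psiN_mul_eq (s : ℂ) {N : ℕ} (hN : 1 ≤ N) {x : ℝ} (hx : 0 < x) :
    psiN s N (N * x) = ((((N : ℝ) ^ (-s.re) : ℝ) : ℂ) * (N : ℂ)⁻¹) * ((x ^ (-s.re) : ℝ) : ℂ) *
      holoPsi s N ((x⁻¹ : ℝ) : ℂ) := by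
  have hN0 : (0 : ℝ) < N := by exact_mod_cast hN
  have hx0 : (x : ℂ) ≠ 0 := by exact_mod_cast hx.ne'
  have hNc : (N : ℂ) ≠ 0 := by exact_mod_cast hN0.ne'
  have hyI := ofReal_sub_I_ne_zero (N * x)
  have h1 := pow_mul_sqrt_wH s hN (mul_pos hN0 hx)
  have h2 : (N : ℂ) / ((N * x : ℝ) : ℂ) = ((x⁻¹ : ℝ) : ℂ) := by
    push_cast
    field_simp
  have h3 : 2 / (1 + I * ((N * x : ℝ) : ℂ)) =
      2 * ((x⁻¹ : ℝ) : ℂ) / (((x⁻¹ : ℝ) : ℂ) + N * I) := by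
    have e : ((x⁻¹ : ℝ) : ℂ) + N * I = (1 + I * ((N * x : ℝ) : ℂ)) / x := by
      push_cast
      field_simp
    have h4 := one_add_I_mul_ofReal_ne_zero (N * x)
    rw [e]
    push_cast at h4 ⊢
    field_simp
  have h5 : ((x⁻¹ : ℝ) : ℂ) / (1 + -((x⁻¹ : ℝ) : ℂ) * I / N) = N / (((N * x : ℝ) : ℂ) - I) := by
    have e : 1 + -((x⁻¹ : ℝ) : ℂ) * I / N = (((N * x : ℝ) : ℂ) - I) / (N * x) := by
      push_cast
      field_simp
      ring
    rw [e]
    push_cast at hyI ⊢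
    field_simp
  have h6 : (((N * x : ℝ) : ℂ) - I) ^ (N - 1) =
      (((N * x : ℝ) : ℂ) - I) ^ N / (((N * x : ℝ) : ℂ) - I) := by
    rw [eq_div_iff hyI, ← pow_succ, Nat.sub_add_cancel hN]
  rw [h2, Real.mul_rpow hN0.le hx.le] at h1
  rw [psiN, pPrev, holoPsi, h3, h5, h6, mul_right_comm, div_mul_eq_mul_div, h1]
  push_cast
  field_simp

theorem prefac_eq (s : ℂ) {x : ℝ} (hx : 0 < x) :
    prefac s x = (((2 : ℝ) ^ s.re : ℝ) : ℂ) * ((x ^ (-s.re) : ℝ) : ℂ) *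
      Complex.exp (s.im * Real.pi / 2 - ((x⁻¹ : ℝ) : ℂ) * I) := by
  rw [prefac, abs_of_pos (by positivity), Real.div_rpow two_pos.le hx.le, Real.rpow_neg hx.le,
    div_eq_mul_inv, Real.sign_of_pos hx, Complex.ofReal_mul]
  congr 2
  push_cast
  ring

theorem Ptilde_eq (s : ℂ) {x : ℝ} (hx : 0 < x) :
    Ptilde s x = (((2 : ℝ) ^ s.re : ℝ) : ℂ) * ((x ^ (-s.re) : ℝ) : ℂ) *
      limitPhi s ((x⁻¹ : ℝ) : ℂ) := by
  rw [Ptilde, prefac_eq s hx, limitPhi, Complex.ofReal_inv x, ← div_eq_mul_inv]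
  ring

theorem Qfun_eq (s : ℂ) {x : ℝ} (hx : 0 < x) :
    Qfun s x = (2 * (((2 : ℝ) ^ s.re : ℝ) : ℂ)) * ((x ^ (-s.re) : ℝ) : ℂ) *
      limitPsi s ((x⁻¹ : ℝ) : ℂ) := by
  rw [Qfun, prefac_eq s hx, limitPsi, Complex.ofReal_inv x, ← div_eq_mul_inv (2 * I)]
  ring

theorem ofReal_mem_unitStrip (u : ℝ) : (u : ℂ) ∈ unitStrip := by
  simp [unitStrip]

theorem Kinf_inv {s : ℂ} (hs : -(1 / 2 : ℝ) < s.re) (u v : ℝ) (hu : 0 < u) (hv : 0 < v) :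
    Kinf s u⁻¹ v⁻¹ = (u * v) ^ (s.re + 1) *
      (limitConst s * dividedWronskian (limitPhi s) (limitPsi s) u v).re := by
  have h := wronskianKernel_inv (cinf s) (fun x hx => Ptilde_eq s hx) (fun x hx => Qfun_eq s hx)
    (fun u => differentiable_limitPhi hs u) (fun u => differentiable_limitPsi hs u) hu hv
  rw [Kinf, ← Complex.re_ofReal_mul, limitConst, ← h]
  rfl

theorem Kscaled_eq_re_wronskianKernel (s : ℂ) {N : ℕ} (hN : 1 ≤ N) (x y : ℝ) :
    Kscaled s N x y = (wronskianKernel (CNs s N) (fun x => phiN s N (N * x))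
      (fun x => psiN s N (N * x)) x y).re := by
  have hN0 : (N : ℝ) ≠ 0 := by exact_mod_cast (by omega : N ≠ 0)
  have hNc : (N : ℂ) ≠ 0 := by exact_mod_cast hN0
  rw [Kscaled, KN, ← Complex.re_ofReal_mul]
  congr 1
  by_cases h : x = y
  · subst h
    simp only [KNC, wronskianKernel, if_true]
    rw [deriv_comp_mul_left, deriv_comp_mul_left]
    simp only [Complex.real_smul]
    ring
  · have h' : (N : ℝ) * x ≠ N * y := fun e => h (mul_left_cancel₀ hN0 e)
    have h'' : (x : ℂ) - y ≠ 0 := sub_ne_zero.2 (by exact_mod_cast h)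
    simp only [KNC, wronskianKernel, if_neg h, if_neg h']
    push_cast
    rw [← mul_sub]
    field_simp

theorem Kscaled_inv (s : ℂ) {N : ℕ} (hN : 1 ≤ N) (u v : ℝ) (hu : 0 < u) (hv : 0 < v) :
    Kscaled s N u⁻¹ v⁻¹ = (u * v) ^ (s.re + 1) *
      (scaledConst s N * dividedWronskian (holoPhi s N) (holoPsi s N) u v).re := by
  have h := wronskianKernel_inv (CNs s N) (Φ := fun x => phiN s N (N * x))
    (Ψ := fun x => psiN s N (N * x)) (fun x hx => phiN_mul_eq s hN hx)
    (fun x hx => psiN_mul_eq s hN hx)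
    (fun u => (differentiableOn_holoPhi s hN).differentiableAt
      (isOpen_unitStrip.mem_nhds (ofReal_mem_unitStrip u)))
    (fun u => (differentiableOn_holoPsi s hN).differentiableAt
      (isOpen_unitStrip.mem_nhds (ofReal_mem_unitStrip u))) hu hv
  rw [Kscaled_eq_re_wronskianKernel s hN, ← Complex.re_ofReal_mul, scaledConst, ← h]

/-- For `Re(s) > −1/2`, the Fredholm determinants `F_N` of the rescaled
kernels `K_[N]` and `F_∞` of `K_∞` are `C³` on `(0,∞)`, and for `p ∈ {0,1,2,3}` the `p`-th
derivative of `F_N` converges pointwise on `(0,∞)` to that of `F_∞` as `N → ∞`. -/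
theorem fredholm_det_derivatives_converge (s : ℂ) (hs : -(1 / 2 : ℝ) < s.re) :
    (∀ N : ℕ, 1 ≤ N → ContDiffOn ℝ 3 (fredholmDet (Kscaled s N)) (Set.Ioi 0)) ∧
    ContDiffOn ℝ 3 (fredholmDet (Kinf s)) (Set.Ioi 0) ∧
    ∀ p : ℕ, p ≤ 3 → ∀ t : ℝ, 0 < t →
      Filter.Tendsto
        (fun N : ℕ => iteratedDerivWithin p (fredholmDet (Kscaled s N)) (Set.Ioi 0) t)
        Filter.atTop
        (nhds (iteratedDerivWithin p (fredholmDet (Kinf s)) (Set.Ioi 0) t)) := by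
  have hpos : ∀ t : ℝ, 0 < t → (t : ℂ) ∈ inverseStrip := fun t => ofReal_mem_inverseStrip
  have hfin (N : ℕ) (hN : 1 ≤ N) := differentiableOn_fredholmSeries_rescaledKernel hs
    (scaledConst s N) (differentiableOn_holoPhi s hN) (differentiableOn_holoPsi s hN)
    (measurable_holoPhi s N) (measurable_holoPsi s N)
  have hlim := differentiableOn_fredholmSeries_rescaledKernel hs (limitConst s)
    (differentiable_limitPhi hs).differentiableOn (differentiable_limitPsi hs).differentiableOn
    (differentiable_limitPhi hs).continuous.measurable
    (differentiable_limitPsi hs).continuous.measurable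
  have hfinEq (N : ℕ) (hN : 1 ≤ N) (t : ℝ) (ht : 0 < t) :=
    fredholmDet_eq_re_fredholmSeries (Kscaled_inv s hN) ht
  have hlimEq (t : ℝ) (ht : 0 < t) := fredholmDet_eq_re_fredholmSeries (Kinf_inv hs) ht
  refine ⟨fun N hN => contDiffOn_Ioi_of_differentiableOn isOpen_inverseStrip hpos (hfin N hN)
      (hfinEq N hN) 3,
    contDiffOn_Ioi_of_differentiableOn isOpen_inverseStrip hpos hlim hlimEq 3,
    fun p _ t ht => ?_⟩
  rw [iteratedDerivWithin_eq_re_of_differentiableOn isOpen_inverseStrip hpos hlim hlimEq p ht]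
  have h := tendsto_iteratedDeriv_fredholmSeries_rescaledKernel hs (tendsto_scaledConst hs)
    (stripBounded_holoPhi hs _) (stripBounded_holoPsi hs _)
    ((eventually_ge_atTop 1).mono fun N hN => differentiableOn_holoPhi s hN)
    ((eventually_ge_atTop 1).mono fun N hN => differentiableOn_holoPsi s hN)
    (measurable_holoPhi s) (measurable_holoPsi s)
    (differentiable_limitPhi hs).differentiableOn (differentiable_limitPsi hs).differentiableOn
    (differentiable_limitPhi hs).continuous.measurable
    (differentiable_limitPsi hs).continuous.measurable
    (fun z _ => tendsto_holoPhi hs z) (fun z _ => tendsto_holoPsi hs z) p (hpos t ht)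
  refine ((Complex.continuous_re.tendsto _).comp h).congr' ?_
  filter_upwards [eventually_ge_atTop 1] with N hN
  exact (iteratedDerivWithin_eq_re_of_differentiableOn isOpen_inverseStrip hpos (hfin N hN)
    (hfinEq N hN) p ht).symm
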